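/- For n ≥ 12, let V = (ℂ²)^{⊗n} carry the Segre of n copies of ℙ¹. Then for every positive integers r and k with r+1 ≤ 2^n − 2^{n−12} and k ≤ (r+1)/(n+1), the general linear subspace of V of dimension r+1 which is tangent to the Segre at k general points is tangent only at those points. -/

import Mathlib

open scoped TensorProduct
open PiTensorProduct

noncomputable section

/-- The space of tensors `V = ℂ^{a₁+1} ⊗ ⋯ ⊗ ℂ^{a_q+1}`. -/
abbrev Ten (q : ℕ) (a : Fin q → ℕ) : Type :=
  ⨂[ℂ] i : Fin q, (Fin (a i + 1) → ℂ)

/-- Index type for the coordinates on the parameter space `W_k`. -/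
abbrev WIdx (q : ℕ) (a : Fin q → ℕ) (k : ℕ) : Type :=
  Fin k × Σ j : Fin q, Fin (a j + 1)

/-- Index type for the standard (decomposable) basis of `Ten q a`. -/
abbrev BIdx (q : ℕ) (a : Fin q → ℕ) : Type := ∀ j : Fin q, Fin (a j + 1)

/-- A tensor is decomposable if it is `v₁ ⊗ ⋯ ⊗ v_q` with all `vᵢ ≠ 0`. -/
def IsDecomposable {q : ℕ} {a : Fin q → ℕ} (t : Ten q a) : Prop :=
  ∃ v : ∀ j : Fin q, Fin (a j + 1) → ℂ, (∀ j, v j ≠ 0) ∧ t = tprod ℂ v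

/-- The affine tangent space at `v₁ ⊗ ⋯ ⊗ v_q` to the cone over the Segre variety:
the span of all tensors obtained by replacing one factor of `v` by an arbitrary vector. -/
def tangent {q : ℕ} (a : Fin q → ℕ) (v : ∀ j : Fin q, Fin (a j + 1) → ℂ) :
    Submodule ℂ (Ten q a) :=
  Submodule.span ℂ
    {x | ∃ (j : Fin q) (u : Fin (a j + 1) → ℂ), x = tprod ℂ (Function.update v j u)}

/-- The map `Φ : W_k → V` sending a `k`-tuple of factor vectors to the sum of the
corresponding decomposable tensors. -/
def Phi {q : ℕ} (a : Fin q → ℕ) {k : ℕ}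
    (p : Fin k → ∀ j : Fin q, Fin (a j + 1) → ℂ) : Ten q a :=
  ∑ i, tprod ℂ (p i)

/-- Evaluation of a polynomial function on `W_k` at a parameter point. -/
def evalW {q : ℕ} {a : Fin q → ℕ} {k : ℕ}
    (F : MvPolynomial (WIdx q a k) ℂ)
    (p : Fin k → ∀ j : Fin q, Fin (a j + 1) → ℂ) : ℂ :=
  MvPolynomial.eval (fun x => p x.1 x.2.1 x.2.2) F

/-- `k`-identifiability of the Segre product `ℙ^{a₁} × ⋯ × ℙ^{a_q}`:
there is a nonzero polynomial function `F` on `W_k` such that whenever `F(p) ≠ 0`,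
the tensor `Φ(p)` has a rank-`k` decomposition, and any two rank-`k` decompositions
of `Φ(p)` agree as multisets of decomposable tensors. -/
def Identifiable (q : ℕ) (a : Fin q → ℕ) (k : ℕ) : Prop :=
  ∃ F : MvPolynomial (WIdx q a k) ℂ,
    (∃ p, evalW F p ≠ 0) ∧
    ∀ p, evalW F p ≠ 0 →
      ((∃ t : Fin k → Ten q a, (∀ i, IsDecomposable (t i)) ∧ ∑ i, t i = Phi a p) ∧
       ∀ s t : Fin k → Ten q a,
         (∀ i, IsDecomposable (s i)) → (∀ i, IsDecomposable (t i)) →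
         ∑ i, s i = Phi a p → ∑ i, t i = Phi a p →
         Finset.univ.val.map s = Finset.univ.val.map t)

/-- The standard decomposable basis vector of `Ten q a` indexed by `f`. -/
def basisVec {q : ℕ} (a : Fin q → ℕ) (f : BIdx q a) : Ten q a :=
  tprod ℂ fun j => Pi.single (f j) 1

/-- The vector of `Ten q a` with coordinates `c` in the standard basis. -/
def fromCoords {q : ℕ} (a : Fin q → ℕ) (c : BIdx q a → ℂ) : Ten q a :=
  ∑ f : BIdx q a, c f • basisVec a f

/-- Evaluation of a polynomial function on `W_k × V^e` at a parameter point. -/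
def evalWV {q : ℕ} {a : Fin q → ℕ} {k e : ℕ}
    (F : MvPolynomial (WIdx q a k ⊕ (Fin e × BIdx q a)) ℂ)
    (p : Fin k → ∀ j : Fin q, Fin (a j + 1) → ℂ)
    (c : Fin e → BIdx q a → ℂ) : ℂ :=
  MvPolynomial.eval (Sum.elim (fun x => p x.1 x.2.1 x.2.2) (fun y => c y.1 y.2)) F

/-- `TangentGeneral q a k d` says: the general linear subspace of `V` of dimension `d`
which is tangent to the Segre at `k` general points is tangent only at those points.
Concretely, with `e = d - k(1 + Σᵢ aᵢ)`, there is a nonzero polynomial function `F` on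
`W_k × V^e` such that whenever `F ≠ 0` at `(p, c)`, the space `L` spanned by the tangent
spaces at the `k` decomposable tensors determined by `p` together with the `e` extra
vectors determined by `c` has dimension exactly `d`, and any decomposable tensor whose
tangent space lies in `L` is a scalar multiple of one of the `k` given ones. -/
def TangentGeneral (q : ℕ) (a : Fin q → ℕ) (k d : ℕ) : Prop :=
  ∃ F : MvPolynomial (WIdx q a k ⊕ (Fin (d - k * (1 + ∑ j, a j)) × BIdx q a)) ℂ,
    (∃ p c, evalWV F p c ≠ 0) ∧
    ∀ p c, evalWV F p c ≠ 0 →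
      (Module.finrank ℂ
          ↥((⨆ i, tangent a (p i)) ⊔
            Submodule.span ℂ (Set.range fun m => fromCoords a (c m))) = d ∧
       ∀ w : ∀ j : Fin q, Fin (a j + 1) → ℂ, (∀ j, w j ≠ 0) →
         tangent a w ≤
           (⨆ i, tangent a (p i)) ⊔
             Submodule.span ℂ (Set.range fun m => fromCoords a (c m)) →
         ∃ (i : Fin k) (t : ℂ), tprod ℂ w = t • tprod ℂ (p i))

namespace SegreTangent

open Matrix

section Lifting

variable {A : Type*} [CommRing A] {κ β : Type*} [Fintype κ] [DecidableEq κ] [Fintype β]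

/-- If some Gram-type determinant of a family is nonzero in a field, then the family is linearly
independent there. -/
theorem linearIndependent_of_det {E : Type*} [Field E] (φ : A →+* E) (V W : Matrix κ β A)
    (h : φ (V * Wᵀ).det ≠ 0) : LinearIndependent E (fun i b => φ (V i b)) := by
  rw [RingHom.map_det, RingHom.mapMatrix_apply, Matrix.map_mul] at h
  rw [Fintype.linearIndependent_iff]
  intro g hg
  have h1 : g ᵥ* (V.map φ) = 0 := by
    ext b
    have := congrFun hg b
    simpa [Matrix.vecMul, dotProduct, Finset.sum_apply] using this
  have h2 : g ᵥ* (V.map φ * Wᵀ.map φ) = 0 := by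
    rw [← Matrix.vecMul_vecMul, h1, Matrix.zero_vecMul]
  exact fun i => congrFun (Matrix.eq_zero_of_vecMul_eq_zero h h2) i

/-- A linearly independent family over a quotient field has a Gram-type determinant mapping
to `1`. -/
theorem exists_det_eq_one {F : Type*} [Field F] (φ : A →+* F) (hφ : Function.Surjective φ)
    (V : Matrix κ β A) (h : LinearIndependent F (fun i b => φ (V i b))) :
    ∃ W : Matrix κ β A, φ (V * Wᵀ).det = 1 := by
  classical
  obtain ⟨g, hg⟩ := (Fintype.linearCombination F (fun i b => φ (V i b))).exists_leftInverse_of_injective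
    (LinearMap.ker_eq_bot.2 (linearIndependent_iff_injective_fintypeLinearCombination.1 h))
  choose ψ hψ using hφ
  refine ⟨Matrix.of fun i b => ψ (g (Pi.single b 1) i), ?_⟩
  rw [RingHom.map_det, RingHom.mapMatrix_apply, Matrix.map_mul]
  have : V.map φ * (Matrix.of fun i b => ψ (g (Pi.single b 1) i))ᵀ.map φ = 1 := by
    ext i j
    have h1 : g (fun b => φ (V i b)) = Pi.single i 1 := by
      have := LinearMap.congr_fun hg (Pi.single i 1)
      simpa [Fintype.linearCombination_apply_single] using this
    have h2 : (fun b => φ (V i b)) = ∑ b, φ (V i b) • (Pi.single b (1 : F) : β → F) := by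
      ext b; simp [Finset.sum_apply, Pi.single_apply]
    rw [h2, map_sum] at h1
    have h3 := congrFun h1 j
    rw [Matrix.one_apply, Matrix.mul_apply]
    simp only [Finset.sum_apply, map_smul, Pi.smul_apply, smul_eq_mul] at h3
    simp only [Matrix.map_apply, Matrix.transpose_apply, Matrix.of_apply, hψ]
    rw [h3, Pi.single_apply]
    simp [eq_comm]
  rw [this, Matrix.det_one]

/-- A functional killing the reduction of a family lifts to a functional killing the family. -/
theorem exists_lift_annihilator {F : Type*} [Field F] (φ : A →+* F) (hφ : Function.Surjective φ)
    (V W : Matrix κ β A) (hW : φ (V * Wᵀ).det = 1) (f₀ : β → F)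
    (hf₀ : ∀ i, f₀ ⬝ᵥ (fun b => φ (V i b)) = 0) :
    ∃ f : β → A, (∀ i, f ⬝ᵥ V i = 0) ∧ ∀ b, φ (f b) = f₀ b := by
  choose ψ hψ using hφ
  set l : β → A := fun b => ψ (f₀ b)
  have hl : φ ∘ (V *ᵥ l) = 0 := by
    ext i
    have := hf₀ i
    simp only [Function.comp_apply, Matrix.mulVec, dotProduct, map_sum, map_mul, l, hψ,
      Pi.zero_apply]
    rw [← this]
    exact Finset.sum_congr rfl fun b _ => mul_comm _ _
  refine ⟨(V * Wᵀ).det • l - Wᵀ *ᵥ ((V * Wᵀ).adjugate *ᵥ (V *ᵥ l)), fun i => ?_, fun b => ?_⟩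
  · have : V *ᵥ ((V * Wᵀ).det • l - Wᵀ *ᵥ ((V * Wᵀ).adjugate *ᵥ (V *ᵥ l))) = 0 := by
      rw [Matrix.mulVec_sub, Matrix.mulVec_smul, Matrix.mulVec_mulVec, Matrix.mulVec_mulVec,
        Matrix.mul_adjugate, Matrix.smul_mulVec, Matrix.one_mulVec, sub_self]
    rw [dotProduct_comm]
    exact congrFun this i
  · have h0 : ∀ M : Matrix β κ A, φ ((M *ᵥ (V *ᵥ l)) b) = 0 := by
      intro M
      simp only [Matrix.mulVec, dotProduct, map_sum, map_mul]
      refine Finset.sum_eq_zero fun i _ => ?_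
      have := congrFun hl i
      simp only [Function.comp_apply, Matrix.mulVec, dotProduct, map_sum, map_mul,
        Pi.zero_apply] at this
      rw [this, mul_zero]
    rw [Matrix.mulVec_mulVec, Pi.sub_apply, map_sub, h0, sub_zero, Pi.smul_apply, smul_eq_mul,
      map_mul, hW, one_mul]
    exact hψ _

end Lifting

section Generic

/-- A property of points of affine space holds generically if it holds off a hypersurface. -/
def Generic {σ : Type*} (P : (σ → ℂ) → Prop) : Prop :=
  ∃ F : MvPolynomial σ ℂ, F ≠ 0 ∧ ∀ x, MvPolynomial.eval x F ≠ 0 → P x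

theorem exists_eval_ne_zero {σ : Type*} {F : MvPolynomial σ ℂ} (hF : F ≠ 0) :
    ∃ x, MvPolynomial.eval x F ≠ 0 := by
  by_contra! h
  exact hF (MvPolynomial.funext fun x => by simpa using h x)

theorem Generic.exists {σ : Type*} {P : (σ → ℂ) → Prop} (h : Generic P) : ∃ x, P x := by
  obtain ⟨F, hF, h⟩ := h
  obtain ⟨x, hx⟩ := exists_eval_ne_zero hF
  exact ⟨x, h x hx⟩

theorem Generic.and {σ : Type*} {P Q : (σ → ℂ) → Prop} (hP : Generic P) (hQ : Generic Q) :
    Generic fun x => P x ∧ Q x := by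
  obtain ⟨F, hF, hP⟩ := hP
  obtain ⟨G, hG, hQ⟩ := hQ
  refine ⟨F * G, mul_ne_zero hF hG, fun x hx => ?_⟩
  rw [map_mul] at hx
  exact ⟨hP x (left_ne_zero_of_mul hx), hQ x (right_ne_zero_of_mul hx)⟩

theorem Generic.comp {σ τ : Type*} {P : (σ → ℂ) → Prop} (hP : Generic P) (e : σ → τ)
    (he : Function.Injective e) : Generic fun x : τ → ℂ => P (x ∘ e) := by
  obtain ⟨F, hF, hP⟩ := hP
  refine ⟨MvPolynomial.rename e F, ?_, fun x hx => hP _ ?_⟩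
  · exact fun h => hF (MvPolynomial.rename_injective e he (by simpa using h))
  · rwa [MvPolynomial.eval_rename] at hx

theorem eval_surjective {σ : Type*} (x : σ → ℂ) :
    Function.Surjective (MvPolynomial.eval x) := fun a => ⟨MvPolynomial.C a, by simp⟩

/-- Linear independence of a polynomial family at one point makes it generic. -/
theorem generic_linearIndependent {σ κ β : Type*} [Fintype κ] [Fintype β]
    (V : κ → β → MvPolynomial σ ℂ) (x : σ → ℂ)
    (h : LinearIndependent ℂ (fun i b => MvPolynomial.eval x (V i b))) :
    Generic fun y : σ → ℂ => LinearIndependent ℂ (fun i b => MvPolynomial.eval y (V i b)) := by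
  classical
  obtain ⟨W, hW⟩ := exists_det_eq_one (MvPolynomial.eval x) (eval_surjective x) (Matrix.of V) h
  refine ⟨(Matrix.of V * Wᵀ).det, fun h0 => ?_, fun y hy => linearIndependent_of_det _ _ _ hy⟩
  rw [h0] at hW
  simp at hW

/-- A functional killing a polynomial family at a point where it is independent extends to a
polynomial family of functionals. -/
theorem exists_polynomial_annihilator {σ κ β : Type*} [Fintype κ] [Fintype β]
    (V : κ → β → MvPolynomial σ ℂ) (x : σ → ℂ)
    (h : LinearIndependent ℂ (fun i b => MvPolynomial.eval x (V i b))) (f₀ : β → ℂ)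
    (hf₀ : ∀ i, f₀ ⬝ᵥ (fun b => MvPolynomial.eval x (V i b)) = 0) :
    ∃ f : β → MvPolynomial σ ℂ, (∀ i, f ⬝ᵥ V i = 0) ∧
      ∀ b, MvPolynomial.eval x (f b) = f₀ b := by
  classical
  obtain ⟨W, hW⟩ := exists_det_eq_one (MvPolynomial.eval x) (eval_surjective x) (Matrix.of V) h
  exact exists_lift_annihilator _ (eval_surjective x) _ W hW f₀ hf₀

end Generic

section Segre

/-- Vertices of the cube, indexing the standard basis of `(ℂ²)^{⊗ n}`. -/
abbrev Cube (n : ℕ) : Type := Fin n → Fin 2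

variable {R : Type*} [CommRing R] {n : ℕ}

/-- Coordinates of the decomposable tensor `p₁ ⊗ ⋯ ⊗ pₙ`. -/
def seg (p : Fin n → Fin 2 → R) : Cube n → R := fun b => ∏ l, p l (b l)

/-- The decomposable tensor of `p`, or the one with `j`-th factor replaced by that of `q`. -/
def tan (p q : Fin n → Fin 2 → R) : Option (Fin n) → Cube n → R
  | none => seg p
  | some j => seg (Function.update p j (q j))

/-- The decomposable tensor of `p` with `j`-th and `l`-th factors replaced by those of `q`. -/
def tan₂ (p q : Fin n → Fin 2 → R) (j l : Fin n) : Cube n → R :=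
  seg (Function.update (Function.update p j (q j)) l (q l))

/-- The Hessian at `p` of the multilinear form `f`, in the directions `q`. -/
def hess (f : Cube n → R) (p q : Fin n → Fin 2 → R) : Matrix (Fin n) (Fin n) R :=
  Matrix.of fun j l => if j = l then 0 else f ⬝ᵥ tan₂ p q j l

theorem tan₂_comm (p q : Fin n → Fin 2 → R) {j l : Fin n} (h : j ≠ l) :
    tan₂ p q j l = tan₂ p q l j := by
  unfold tan₂
  rw [Function.update_comm h]

theorem hess_comm (f : Cube n → R) (p q : Fin n → Fin 2 → R) (j l : Fin n) :
    hess f p q j l = hess f p q l j := by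
  unfold hess
  by_cases h : j = l
  · simp [h]
  · simp [h, Ne.symm h, tan₂_comm p q h]

theorem sum_cube_succ {M : Type*} [AddCommMonoid M] (g : Cube (n + 1) → M) :
    ∑ b, g b = ∑ e, ∑ b : Cube n, g (Fin.cons e b) := by
  rw [← (Fin.consEquiv (fun _ : Fin (n + 1) => Fin 2)).sum_comp, Fintype.sum_prod_type]
  rfl

theorem seg_cons (a : Fin 2 → R) (p : Fin n → Fin 2 → R) (e : Fin 2) (b : Cube n) :
    seg (Fin.cons a p : Fin (n + 1) → Fin 2 → R) (Fin.cons e b : Cube (n + 1)) =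
      a e * seg p b := by
  simp [seg, Fin.prod_univ_succ]

theorem dotProduct_seg_cons (f : Cube (n + 1) → R) (a : Fin 2 → R) (p : Fin n → Fin 2 → R) :
    f ⬝ᵥ seg (Fin.cons a p : Fin (n + 1) → Fin 2 → R) =
      ∑ e, a e * ((fun b => f (Fin.cons e b)) ⬝ᵥ seg p) := by
  rw [dotProduct, sum_cube_succ]
  refine Finset.sum_congr rfl fun e _ => ?_
  rw [dotProduct, Finset.mul_sum]
  refine Finset.sum_congr rfl fun b _ => ?_
  rw [seg_cons]; ring

theorem map_seg {S : Type*} [CommRing S] (φ : R →+* S) (p : Fin n → Fin 2 → R) (b : Cube n) :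
    φ (seg p b) = seg (fun l c => φ (p l c)) b := by
  simp [seg]

theorem map_tan {S : Type*} [CommRing S] (φ : R →+* S) (p q : Fin n → Fin 2 → R)
    (o : Option (Fin n)) (b : Cube n) :
    φ (tan p q o b) = tan (fun l c => φ (p l c)) (fun l c => φ (q l c)) o b := by
  cases o with
  | none => exact map_seg φ p b
  | some j =>
    simp only [tan, map_seg]
    congr 1
    funext l c
    by_cases h : l = j
    · subst h; simp
    · simp [h]

theorem map_tan₂ {S : Type*} [CommRing S] (φ : R →+* S) (p q : Fin n → Fin 2 → R)
    (j l : Fin n) (b : Cube n) :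
    φ (tan₂ p q j l b) = tan₂ (fun l c => φ (p l c)) (fun l c => φ (q l c)) j l b := by
  simp only [tan₂, map_seg]
  congr 1
  funext m c
  by_cases h : m = l
  · subst h; simp
  · by_cases h' : m = j
    · subst h'; simp [h]
    · simp [h, h']

theorem map_dotProduct' {S β : Type*} [CommRing S] [Fintype β] (φ : R →+* S) (v w : β → R) :
    φ (v ⬝ᵥ w) = (fun b => φ (v b)) ⬝ᵥ (fun b => φ (w b)) := by
  simp [dotProduct]

theorem map_det_hess {S : Type*} [CommRing S] (φ : R →+* S) (f : Cube n → R)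
    (p q : Fin n → Fin 2 → R) :
    φ (hess f p q).det =
      (hess (fun b => φ (f b)) (fun l c => φ (p l c)) (fun l c => φ (q l c))).det := by
  rw [RingHom.map_det]
  congr 1
  ext j l
  simp only [hess, RingHom.mapMatrix_apply, Matrix.map_apply, Matrix.of_apply]
  split_ifs
  · simp
  · rw [map_dotProduct']
    simp only [map_tan₂]

theorem seg_single (b : Cube n) :
    seg (fun l => Pi.single (b l) (1 : R)) = Pi.single b 1 := by
  funext c
  by_cases h : c = b
  · subst h; simp [seg]
  · rw [Pi.single_eq_of_ne h]
    obtain ⟨l, hl⟩ := Function.ne_iff.1 h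
    exact Finset.prod_eq_zero (Finset.mem_univ l) (by simp [hl])

end Segre

section PureTensors

/-- A nonzero multilinear form is generically nonzero. -/
theorem generic_dotProduct_seg {n : ℕ} {f : Cube n → ℂ} (hf : f ≠ 0) :
    Generic fun x : Fin n × Fin 2 → ℂ => f ⬝ᵥ seg (fun l c => x (l, c)) ≠ 0 := by
  have key : ∀ x : Fin n × Fin 2 → ℂ, MvPolynomial.eval x
      (∑ b, MvPolynomial.C (f b) * seg (fun l c => MvPolynomial.X (l, c)) b) =
      f ⬝ᵥ seg (fun l c => x (l, c)) := by
    intro x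
    simp [map_seg, dotProduct]
  refine ⟨_, fun h => ?_, fun x hx => (key x).symm.trans_ne hx⟩
  obtain ⟨b, hb⟩ := Function.ne_iff.1 hf
  have := key (fun r => (Pi.single (b r.1) (1 : ℂ) : Fin 2 → ℂ) r.2)
  rw [h] at this
  apply hb
  simp only [map_zero] at this
  rw [Pi.zero_apply, this]
  have h2 := seg_single (R := ℂ) b
  rw [h2]
  simp

/-- A multilinear form on `(ℂ²)^n` vanishing at all zeros of another one is a multiple of it. -/
theorem eq_smul_of_forall_seg {n : ℕ} (f h : Cube n → ℂ)
    (H : ∀ x : Fin n → Fin 2 → ℂ, f ⬝ᵥ seg x = 0 → h ⬝ᵥ seg x = 0) : ∃ c : ℂ, h = c • f := by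
  induction n with
  | zero =>
    have h1 : ∀ (g : Cube 0 → ℂ) (x), g ⬝ᵥ seg x = g default := by
      intro g x
      rw [dotProduct, Fintype.sum_unique]
      simp only [seg, Finset.univ_eq_empty, Finset.prod_empty, mul_one]
      exact congrArg g (Subsingleton.elim _ _)
    by_cases h0 : f default = 0
    · refine ⟨0, ?_⟩
      funext b
      rw [Subsingleton.elim b default]
      simpa [h1] using H default (by simpa [h1] using h0)
    · refine ⟨h default / f default, ?_⟩
      funext b
      rw [Subsingleton.elim b default, Pi.smul_apply, smul_eq_mul, div_mul_cancel₀ _ h0]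
  | succ n ih =>
    have hc : ∀ e, ∃ c : ℂ, (fun b => h (Fin.cons e b)) = c • fun b => f (Fin.cons e b) := by
      intro e
      refine ih _ _ fun x hx => ?_
      have := H (Fin.cons (Pi.single e 1) x)
      rw [dotProduct_seg_cons, dotProduct_seg_cons] at this
      simpa [Pi.single_apply, hx] using this
    choose c hc using hc
    have hcons : ∀ d : ℂ, (∀ e, (fun b => h (Fin.cons e b)) = d • fun b => f (Fin.cons e b)) →
        h = d • f := by
      intro d hd
      funext b
      have := congrFun (hd (b 0)) (Fin.tail b)
      simpa [Fin.cons_self_tail] using this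
    by_cases h0 : (fun b => f (Fin.cons 0 b)) = 0
    · refine ⟨c 1, hcons _ fun e => ?_⟩
      fin_cases e
      · simpa [h0] using hc 0
      · exact hc 1
    by_cases h1 : (fun b => f (Fin.cons 1 b)) = 0
    · refine ⟨c 0, hcons _ fun e => ?_⟩
      fin_cases e
      · exact hc 0
      · simpa [h1] using hc 1
    obtain ⟨x, hx0, hx1⟩ :=
      ((generic_dotProduct_seg h0).and (generic_dotProduct_seg h1)).exists
    have h01 : c 0 = c 1 := by
      have := H (Fin.cons ![(fun b => f (Fin.cons 1 b)) ⬝ᵥ seg (fun l c => x (l, c)),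
        -((fun b => f (Fin.cons 0 b)) ⬝ᵥ seg (fun l c => x (l, c)))] (fun l c => x (l, c)))
      rw [dotProduct_seg_cons, dotProduct_seg_cons, Fin.sum_univ_two, Fin.sum_univ_two,
        hc, hc, smul_dotProduct, smul_dotProduct] at this
      simp only [cons_val_zero, cons_val_one, smul_eq_mul] at this
      have h2 := this (by ring)
      have h3 : (c 0 - c 1) * (((fun b => f (Fin.cons 1 b)) ⬝ᵥ seg (fun l c => x (l, c))) *
        ((fun b => f (Fin.cons 0 b)) ⬝ᵥ seg (fun l c => x (l, c)))) = 0 := by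
        linear_combination h2
      have h4 := (mul_eq_zero.1 h3).resolve_right (mul_ne_zero hx1 hx0)
      exact sub_eq_zero.1 h4
    refine ⟨c 0, hcons _ fun e => ?_⟩
    fin_cases e
    · exact hc 0
    · rw [h01]; exact hc 1

/-- Decomposable tensors killed by `f` extend an independent family killed by `f`. -/
theorem exists_extend_by_seg {n : ℕ} (f : Cube n → ℂ) (m : ℕ) :
    ∀ {κ : Type} [Fintype κ] (v : κ → Cube n → ℂ), LinearIndependent ℂ v →
    (∀ i, f ⬝ᵥ v i = 0) →
    Fintype.card κ + m ≤ Module.finrank ℂ (LinearMap.ker (dotProductEquiv ℂ (Cube n) f)) →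
    ∃ s : Fin m → Fin n → Fin 2 → ℂ,
      LinearIndependent ℂ (Sum.elim v fun t => seg (s t)) ∧ ∀ t, f ⬝ᵥ seg (s t) = 0 := by
  induction m with
  | zero =>
    intro κ _ v hv _ _
    refine ⟨Fin.elim0, ?_, fun t => t.elim0⟩
    have : Sum.elim v (fun t : Fin 0 => seg (Fin.elim0 t)) = v ∘ (Equiv.sumEmpty κ (Fin 0)) := by
      funext i
      rcases i with i | i
      · rfl
      · exact i.elim0
    rw [this]
    exact hv.comp _ (Equiv.injective _)
  | succ m ih =>
    intro κ _ v hv hf hcard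
    have hlt : Submodule.span ℂ (Set.range v) < LinearMap.ker (dotProductEquiv ℂ (Cube n) f) := by
      refine lt_of_le_of_ne (Submodule.span_le.2 ?_) fun h => ?_
      · rintro _ ⟨i, rfl⟩
        exact hf i
      · rw [← h, finrank_span_eq_card hv] at hcard
        omega
    obtain ⟨y, hy, hyn⟩ := SetLike.exists_of_lt hlt
    obtain ⟨g, hgy, hg⟩ := Submodule.exists_dual_map_eq_bot_of_notMem hyn inferInstance
    obtain ⟨h, rfl⟩ := (dotProductEquiv ℂ (Cube n)).surjective g
    obtain ⟨x, hfx, hhx⟩ : ∃ x : Fin n → Fin 2 → ℂ, f ⬝ᵥ seg x = 0 ∧ h ⬝ᵥ seg x ≠ 0 := by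
      by_contra! H
      obtain ⟨c, rfl⟩ := eq_smul_of_forall_seg f h H
      apply hgy
      rw [map_smul, LinearMap.smul_apply, LinearMap.mem_ker.1 hy, smul_zero]
    have hx : seg x ∉ Submodule.span ℂ (Set.range v) := fun hmem => hhx <| by
      have : dotProductEquiv ℂ (Cube n) h (seg x) ∈
          (Submodule.span ℂ (Set.range v)).map (dotProductEquiv ℂ (Cube n) h) :=
        Submodule.mem_map_of_mem hmem
      rw [hg] at this
      simpa using this
    obtain ⟨s, hs, hfs⟩ := ih (κ := Option κ) (fun o => o.elim (seg x) v)
      (linearIndependent_option.2 ⟨hv, hx⟩)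
      (by rintro (_ | i); exacts [hfx, hf i]) (by rw [Fintype.card_option]; omega)
    refine ⟨Fin.cons x s, ?_, fun t => ?_⟩
    · have hcomp : (Sum.elim v fun t : Fin (m + 1) => seg ((Fin.cons x s : Fin (m + 1) → _) t)) =
          (Sum.elim (fun o : Option κ => o.elim (seg x) v) fun t => seg (s t)) ∘
          (Sum.elim (fun i => Sum.inl (some i))
            (Fin.cons (Sum.inl none) Sum.inr : Fin (m + 1) → Option κ ⊕ Fin m)) := by
        funext i
        rcases i with i | i
        · rfl
        · refine Fin.cases ?_ (fun t => ?_) i <;> simp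
      rw [hcomp]
      refine hs.comp _ ?_
      rintro (i | i) (j | j) hij
      · simpa using hij
      · revert hij; refine Fin.cases ?_ (fun t => ?_) j <;> simp
      · revert hij; refine Fin.cases ?_ (fun t => ?_) i <;> simp
      · revert hij
        refine Fin.cases ?_ (fun t => ?_) i <;> refine Fin.cases ?_ (fun t => ?_) j <;> simp
    · refine Fin.cases ?_ (fun t => ?_) t
      · simpa using hfx
      · simpa using hfs t

theorem finrank_ker_dotProduct {n : ℕ} (f : Cube n → ℂ) :
    2 ^ n ≤ Module.finrank ℂ (LinearMap.ker (dotProductEquiv ℂ (Cube n) f)) + 1 := by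
  have h := LinearMap.finrank_range_add_finrank_ker (dotProductEquiv ℂ (Cube n) f)
  have h2 := Submodule.finrank_le (LinearMap.range (dotProductEquiv ℂ (Cube n) f))
  simp only [Module.finrank_self, Module.finrank_fintype_fun_eq_card, Fintype.card_pi,
    Fintype.card_fin, Finset.prod_const, Finset.card_univ] at h h2
  omega

theorem finrank_ker_dotProduct_zero {n : ℕ} :
    Module.finrank ℂ (LinearMap.ker (dotProductEquiv ℂ (Cube n) 0)) = 2 ^ n := by
  rw [map_zero, LinearMap.ker_zero, finrank_top]
  simp

end PureTensors

section Config

/-- Coordinates of a family of points with chosen tangent directions. -/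
abbrev PIdx (ι : Type) (n : ℕ) : Type := ι × Bool × Fin n × Fin 2

variable {R : Type*} [CommRing R] {n : ℕ} {ι T : Type}

/-- The factors of the `i`-th point. -/
def pt (x : PIdx ι n → R) (i : ι) : Fin n → Fin 2 → R := fun l c => x (i, false, l, c)

/-- The tangent directions at the `i`-th point. -/
def dir (x : PIdx ι n → R) (i : ι) : Fin n → Fin 2 → R := fun l c => x (i, true, l, c)

/-- Generators of the tangent spaces at a family of points. -/
def gens (x : PIdx ι n → R) : ι × Option (Fin n) → Cube n → R :=
  fun g => tan (pt x g.1) (dir x g.1) g.2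

/-- Generators of the tangent spaces at the points indexed by `ι`, together with the points
indexed by `T`. -/
def gensPts (x : PIdx (ι ⊕ T) n → R) : (ι × Option (Fin n)) ⊕ T → Cube n → R :=
  Sum.elim (fun g => tan (pt x (Sum.inl g.1)) (dir x (Sum.inl g.1)) g.2)
    (fun t => seg (pt x (Sum.inr t)))

/-- There are points indexed by `ι` whose tangent spaces are independent and annihilated by a form
whose Hessian at the `i`-th point is nondegenerate. -/
def Config (F : Type*) [Field F] (n : ℕ) (ι : Type) (i : ι) : Prop :=
  ∃ (x : PIdx ι n → F) (f : Cube n → F), LinearIndependent F (gens x) ∧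
    (∀ g, f ⬝ᵥ gens x g = 0) ∧ (hess f (pt x i) (dir x i)).det ≠ 0

theorem Config.of_injective {F : Type*} [Field F] {ι ι' : Type} {i : ι'}
    (e : ι' → ι) (he : Function.Injective e) (h : Config F n ι (e i)) : Config F n ι' i := by
  obtain ⟨x, f, hli, hf, hd⟩ := h
  exact ⟨fun r => x (e r.1, r.2), f, hli.comp (Prod.map e id) (he.prodMap Function.injective_id),
    fun g => hf (e g.1, g.2), hd⟩

theorem Config.of_card_le {F : Type*} [Field F] {ι ι' : Type} [Fintype ι] [Fintype ι'] {i : ι}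
    (h : Config F n ι i) (hc : Fintype.card ι' ≤ Fintype.card ι) (i' : ι') : Config F n ι' i' := by
  classical
  obtain ⟨e⟩ := Function.Embedding.nonempty_of_card_le hc
  refine Config.of_injective (fun a => Equiv.swap (e i') i (e a))
    ((Equiv.injective _).comp e.injective) ?_
  simpa using h

theorem map_gens {S : Type*} [CommRing S] (φ : R →+* S) (x : PIdx ι n → R)
    (g : ι × Option (Fin n)) (b : Cube n) :
    φ (gens x g b) = gens (fun r => φ (x r)) g b := map_tan φ _ _ _ _

theorem map_gensPts {S : Type*} [CommRing S] (φ : R →+* S) (x : PIdx (ι ⊕ T) n → R)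
    (g : (ι × Option (Fin n)) ⊕ T) (b : Cube n) :
    φ (gensPts x g b) = gensPts (fun r => φ (x r)) g b := by
  rcases g with g | t
  · exact map_tan φ _ _ _ _
  · exact map_seg φ _ _

theorem eval_gensPts (y : PIdx (ι ⊕ T) n → ℂ) (g : (ι × Option (Fin n)) ⊕ T) (b : Cube n) :
    MvPolynomial.eval y (gensPts MvPolynomial.X g b) = gensPts y g b := by
  rw [map_gensPts]
  simp

/-- Points extending an independent set of tangent generators, killed by a given form. -/
theorem exists_gensPts [Fintype ι] [Fintype T] {κ : Type} [Fintype κ]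
    (e : κ → ι × Option (Fin n)) (x : PIdx ι n → ℂ)
    (hx : LinearIndependent ℂ (gens x ∘ e)) (f : Cube n → ℂ) (hf : ∀ k, f ⬝ᵥ gens x (e k) = 0)
    (hc : Fintype.card κ + Fintype.card T ≤
      Module.finrank ℂ (LinearMap.ker (dotProductEquiv ℂ (Cube n) f))) :
    ∃ y : PIdx (ι ⊕ T) n → ℂ, (∀ i r, y (Sum.inl i, r) = x (i, r)) ∧
      LinearIndependent ℂ (gensPts y ∘ Sum.map e id) ∧
      ∀ t, f ⬝ᵥ seg (pt y (Sum.inr t)) = 0 := by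
  obtain ⟨s, hs, hfs⟩ := exists_extend_by_seg f (Fintype.card T) (gens x ∘ e) hx hf hc
  refine ⟨fun r => Sum.elim (fun i => x (i, r.2))
    (fun t => s (Fintype.equivFin T t) r.2.2.1 r.2.2.2) r.1, fun i r => rfl, ?_, fun t => hfs _⟩
  have := hs.comp (Sum.map id (Fintype.equivFin T)) (Function.injective_id.sumMap
    (Equiv.injective _))
  convert this using 1
  funext k
  rcases k with k | t <;> rfl

theorem generic_gensPts [Fintype ι] [Fintype T] {κ : Type} [Fintype κ]
    (e : κ → ι × Option (Fin n)) (he : Function.Injective e)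
    (x : PIdx ι n → ℂ) (hx : LinearIndependent ℂ (gens x))
    (hc : Fintype.card κ + Fintype.card T ≤ 2 ^ n) :
    Generic fun y : PIdx (ι ⊕ T) n → ℂ => LinearIndependent ℂ (gensPts y ∘ Sum.map e id) := by
  obtain ⟨y, -, hy, -⟩ := exists_gensPts (T := T) e x (hx.comp e he) 0 (by simp)
    (by rwa [finrank_ker_dotProduct_zero])
  have := generic_linearIndependent (fun (k : κ ⊕ T) b =>
    gensPts (MvPolynomial.X : PIdx (ι ⊕ T) n → MvPolynomial _ ℂ) (Sum.map e id k) b) y (by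
      simp only [eval_gensPts]; exact hy)
  simp only [eval_gensPts] at this
  exact this

theorem Config.generic [Fintype ι] [Fintype T] {i : ι} (h : Config ℂ n ι i)
    (hc : Fintype.card ι * (n + 1) + Fintype.card T < 2 ^ n) :
    Generic fun y : PIdx (ι ⊕ T) n → ℂ => LinearIndependent ℂ (gensPts y) ∧
      ∃ f : Cube n → ℂ, (∀ g, f ⬝ᵥ gensPts y g = 0) ∧
        (hess f (pt y (Sum.inl i)) (dir y (Sum.inl i))).det ≠ 0 := by
  obtain ⟨x, f₀, hx, hf₀, hd⟩ := h
  obtain ⟨y, hyx, hy, hyf⟩ := exists_gensPts (T := T) id x hx f₀ hf₀ (by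
    have := finrank_ker_dotProduct f₀
    simp only [Fintype.card_prod, Fintype.card_option, Fintype.card_fin]
    omega)
  have hy' : LinearIndependent ℂ (gensPts y) := by simpa using hy
  have hpt : ∀ j, pt y (Sum.inl j) = pt x j := fun j => funext₂ fun l c => hyx j _
  have hdir : ∀ j, dir y (Sum.inl j) = dir x j := fun j => funext₂ fun l c => hyx j _
  have hfy : ∀ g, f₀ ⬝ᵥ gensPts y g = 0 := by
    rintro (g | t)
    · have : gensPts y (Sum.inl g) = gens x g := by
        simp only [gensPts, gens, Sum.elim_inl, hpt, hdir]
      rw [this]; exact hf₀ g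
    · exact hyf t
  let V := gensPts (MvPolynomial.X : PIdx (ι ⊕ T) n → MvPolynomial (PIdx (ι ⊕ T) n) ℂ)
  have h1 := generic_linearIndependent V y (by simp only [V, eval_gensPts]; exact hy')
  obtain ⟨f, hf, hff⟩ := exists_polynomial_annihilator V y
    (by simp only [V, eval_gensPts]; exact hy') f₀ (by simp only [V, eval_gensPts]; exact hfy)
  have hdet : ∀ z : PIdx (ι ⊕ T) n → ℂ, MvPolynomial.eval z (hess f
      (pt (MvPolynomial.X : PIdx (ι ⊕ T) n → MvPolynomial (PIdx (ι ⊕ T) n) ℂ) (Sum.inl i))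
      (dir MvPolynomial.X (Sum.inl i))).det =
      (hess (fun b => MvPolynomial.eval z (f b)) (pt z (Sum.inl i)) (dir z (Sum.inl i))).det := by
    intro z
    rw [map_det_hess]
    simp only [pt, dir, MvPolynomial.eval_X]
    rfl
  have h2 : Generic fun z : PIdx (ι ⊕ T) n → ℂ =>
      (hess (fun b => MvPolynomial.eval z (f b)) (pt z (Sum.inl i))
        (dir z (Sum.inl i))).det ≠ 0 := by
    refine ⟨_, fun h0 => ?_, fun z hz => (hdet z).symm.trans_ne hz⟩
    have := hdet y
    rw [h0, map_zero] at this
    refine hd ?_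
    rw [this]
    simp only [hpt, hdir, hff]
  simp only [V, eval_gensPts] at h1
  obtain ⟨F, hF, hFP⟩ := h1.and h2
  refine ⟨F, hF, fun z hz => ⟨(hFP z hz).1, fun b => MvPolynomial.eval z (f b), fun g => ?_,
    (hFP z hz).2⟩⟩
  have := congrArg (MvPolynomial.eval z) (hf g)
  rw [map_dotProduct', map_zero] at this
  simpa only [V, eval_gensPts] using this

end Config

section Cons

variable {R : Type*} [CommRing R] {n : ℕ}

/-- The tensor with slice `u` at the vertex `e` of the new factor, and `0` at the other vertex. -/
def place (e : Fin 2) (u : Cube n → R) : Cube (n + 1) → R :=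
  fun b => if b 0 = e then u (Fin.tail b) else 0

/-- The slice of a tensor at the vertex `e` of the first factor. -/
def slice (e : Fin 2) (f : Cube (n + 1) → R) : Cube n → R := fun b => f (Fin.cons e b)

theorem slice_place (e e' : Fin 2) (u : Cube n → R) :
    slice e' (place e u) = if e' = e then u else 0 := by
  funext b
  by_cases h : e' = e <;> simp [slice, place, h]

theorem dotProduct_place (f : Cube (n + 1) → R) (e : Fin 2) (u : Cube n → R) :
    f ⬝ᵥ place e u = slice e f ⬝ᵥ u := by
  rw [dotProduct, sum_cube_succ, Finset.sum_eq_single e]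
  · simp [dotProduct, slice, place]
  · intro e' _ h
    simp [place, h]
  · simp

theorem seg_cons_single (e : Fin 2) (p : Fin n → Fin 2 → R) :
    seg (Fin.cons (Pi.single e 1) p : Fin (n + 1) → Fin 2 → R) = place e (seg p) := by
  funext b
  rw [← Fin.cons_self_tail b, seg_cons]
  simp [place, Pi.single_apply]

variable (p q : Fin n → Fin 2 → R) (e e' : Fin 2)

theorem tan_cons_none :
    tan (Fin.cons (Pi.single e 1) p : Fin (n + 1) → Fin 2 → R) (Fin.cons (Pi.single e' 1) q) none =
      place e (seg p) := seg_cons_single e p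

theorem tan_cons_zero :
    tan (Fin.cons (Pi.single e 1) p : Fin (n + 1) → Fin 2 → R) (Fin.cons (Pi.single e' 1) q)
      (some 0) = place e' (seg p) := by
  rw [tan, Fin.cons_zero, Fin.update_cons_zero, seg_cons_single]

theorem tan_cons_succ (j : Fin n) :
    tan (Fin.cons (Pi.single e 1) p : Fin (n + 1) → Fin 2 → R) (Fin.cons (Pi.single e' 1) q)
      (some j.succ) = place e (tan p q (some j)) := by
  rw [tan, Fin.cons_succ, ← Fin.cons_update, seg_cons_single]; rfl

theorem hess_cons_zero_zero (f : Cube (n + 1) → R) :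
    hess f (Fin.cons (Pi.single e 1) p) (Fin.cons (Pi.single e' 1) q) 0 0 = 0 := by
  simp [hess]

theorem hess_cons_succ_zero (f : Cube (n + 1) → R) (j : Fin n) :
    hess f (Fin.cons (Pi.single e 1) p) (Fin.cons (Pi.single e' 1) q) j.succ 0 =
      slice e' f ⬝ᵥ tan p q (some j) := by
  rw [hess, Matrix.of_apply, if_neg (Fin.succ_ne_zero j), tan₂, Fin.cons_succ, Fin.cons_zero,
    ← Fin.cons_update, Fin.update_cons_zero, seg_cons_single, dotProduct_place]
  rfl

theorem hess_cons_zero_succ (f : Cube (n + 1) → R) (j : Fin n) :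
    hess f (Fin.cons (Pi.single e 1) p) (Fin.cons (Pi.single e' 1) q) 0 j.succ =
      slice e' f ⬝ᵥ tan p q (some j) := by
  rw [hess_comm, hess_cons_succ_zero]

theorem hess_cons_succ_succ (f : Cube (n + 1) → R) (j l : Fin n) :
    hess f (Fin.cons (Pi.single e 1) p) (Fin.cons (Pi.single e' 1) q) j.succ l.succ =
      hess (slice e f) p q j l := by
  by_cases h : j = l
  · simp [hess, h]
  · rw [hess, hess, Matrix.of_apply, Matrix.of_apply, if_neg h,
      if_neg (fun h' => h (Fin.succ_injective _ h')), tan₂, Fin.cons_succ, Fin.cons_succ,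
      ← Fin.cons_update, ← Fin.cons_update, seg_cons_single, dotProduct_place]
    rfl

/-- Families placed at the two vertices are jointly independent. -/
theorem linearIndependent_place {F : Type*} [Field F] {K₀ K₁ : Type*} [Fintype K₀] [Fintype K₁]
    {u₀ : K₀ → Cube n → F} {u₁ : K₁ → Cube n → F} (h₀ : LinearIndependent F u₀)
    (h₁ : LinearIndependent F u₁) :
    LinearIndependent F (Sum.elim (fun k => place 0 (u₀ k)) (fun k => place 1 (u₁ k))) := by
  rw [Fintype.linearIndependent_iff] at *
  intro g hg
  rw [Fintype.sum_sum_type] at hg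
  have key : ∀ e b, (∑ k, g (Sum.inl k) * slice e (place 0 (u₀ k)) b) +
      ∑ k, g (Sum.inr k) * slice e (place 1 (u₁ k)) b = 0 := by
    intro e b
    have := congrFun hg (Fin.cons e b)
    simpa [Finset.sum_apply, slice] using this
  have e0 := h₀ (fun k => g (Sum.inl k)) (by
    funext b
    simpa [slice_place, Finset.sum_apply] using key 0 b)
  have e1 := h₁ (fun k => g (Sum.inr k)) (by
    funext b
    simpa [slice_place, Finset.sum_apply] using key 1 b)
  rintro (k | k)
  exacts [e0 k, e1 k]

end Cons

section Isotropic

/-- A nondegenerate quadratic form does not vanish on a subspace of more than half the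
dimension. -/
theorem exists_quadratic_ne_zero {n : ℕ} (M : Matrix (Fin n) (Fin n) ℂ) (hM : M.det ≠ 0)
    (hs : M.IsSymm) (U : Submodule ℂ (Fin n → ℂ)) (hU : n < 2 * Module.finrank ℂ U) :
    ∃ g ∈ U, g ⬝ᵥ M *ᵥ g ≠ 0 := by
  by_contra! h
  have hsym : ∀ g g', g ⬝ᵥ M *ᵥ g' = g' ⬝ᵥ M *ᵥ g := by
    intro g g'
    rw [dotProduct_mulVec, ← mulVec_transpose, hs.eq, dotProduct_comm]
  have hpol : ∀ g ∈ U, ∀ g' ∈ U, g ⬝ᵥ M *ᵥ g' = 0 := by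
    intro g hg g' hg'
    have := h (g + g') (U.add_mem hg hg')
    rw [mulVec_add, dotProduct_add, add_dotProduct, add_dotProduct, h g hg, h g' hg',
      hsym g' g] at this
    linear_combination this / 2
  let L : (Fin n → ℂ) →ₗ[ℂ] Module.Dual ℂ (Fin n → ℂ) :=
    (dotProductEquiv ℂ (Fin n)).toLinearMap ∘ₗ M.mulVecLin
  have hinj : Function.Injective L :=
    (dotProductEquiv ℂ (Fin n)).injective.comp
      (Matrix.mulVec_injective_iff_isUnit.2 ((Matrix.isUnit_iff_isUnit_det _).2 hM.isUnit))
  have hle : U.map L ≤ U.dualAnnihilator := by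
    rintro _ ⟨g', hg', rfl⟩
    rw [Submodule.mem_dualAnnihilator]
    intro g hg
    have := hpol g hg g' hg'
    rw [dotProduct_comm] at this
    exact this
  have h1 := Submodule.finrank_mono hle
  rw [(Submodule.equivMapOfInjective L hinj U).symm.finrank_eq] at h1
  have h2 := Subspace.finrank_add_finrank_dualAnnihilator_eq U
  rw [Module.finrank_fintype_fun_eq_card, Fintype.card_fin] at h2
  omega

end Isotropic

section Lift

variable {R : Type*} [CommRing R] {n : ℕ} {Ω : Type}

/-- Points with one more factor, placed at the vertices prescribed by `ε`. -/
def lift (ε : Ω → Fin 2) (x : PIdx Ω n → R) : PIdx Ω (n + 1) → R := fun r =>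
  (Fin.cons (Pi.single (if r.2.1 then 1 - ε r.1 else ε r.1) 1) (fun l c => x (r.1, r.2.1, l, c)) :
    Fin (n + 1) → Fin 2 → R) r.2.2.1 r.2.2.2

theorem pt_lift (ε : Ω → Fin 2) (x : PIdx Ω n → R) (i : Ω) :
    pt (lift ε x) i = Fin.cons (Pi.single (ε i) 1) (pt x i) := rfl

theorem dir_lift (ε : Ω → Fin 2) (x : PIdx Ω n → R) (i : Ω) :
    dir (lift ε x) i = Fin.cons (Pi.single (1 - ε i) 1) (dir x i) := rfl

/-- Reindexing of a family of points. -/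
def reindex {Ω' : Type} (e : Ω' → Ω) (x : PIdx Ω n → R) : PIdx Ω' n → R :=
  fun r => x (e r.1, r.2)

theorem Generic.reindex {Ω' : Type} {P : (PIdx Ω' n → ℂ) → Prop} (h : Generic P) (e : Ω' → Ω)
    (he : Function.Injective e) : Generic fun x : PIdx Ω n → ℂ => P (reindex e x) :=
  h.comp (Prod.map e id) (he.prodMap Function.injective_id)

/-- Independence of tangent spaces and points in `n + 1` factors decouples at the two vertices. -/
theorem linearIndependent_gensPts_lift {F : Type*} [Field F] {A B S₀ S₁ : Type}
    [Fintype A] [Fintype B] [Fintype S₀] [Fintype S₁]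
    (x : PIdx ((A ⊕ B) ⊕ (S₀ ⊕ S₁)) n → F)
    (h₀ : LinearIndependent F (gensPts (reindex (Sum.elim (Sum.inl ∘ Sum.inl)
      (Sum.elim (Sum.inl ∘ Sum.inr) (Sum.inr ∘ Sum.inl)) : A ⊕ (B ⊕ S₀) → _) x)))
    (h₁ : LinearIndependent F (gensPts (reindex (Sum.elim (Sum.inl ∘ Sum.inr)
      (Sum.elim (Sum.inl ∘ Sum.inl) (Sum.inr ∘ Sum.inr)) : B ⊕ (A ⊕ S₁) → _) x))) :
    LinearIndependent F (gensPts (lift (Sum.elim (Sum.elim 0 1) (Sum.elim 0 1)) x)) := by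
  let ψ : ((A ⊕ B) × Option (Fin (n + 1))) ⊕ (S₀ ⊕ S₁) →
      ((A × Option (Fin n)) ⊕ (B ⊕ S₀)) ⊕ ((B × Option (Fin n)) ⊕ (A ⊕ S₁))
    | Sum.inl (Sum.inl a, none) => Sum.inl (Sum.inl (a, none))
    | Sum.inl (Sum.inl a, some j) =>
      Fin.cases (Sum.inr (Sum.inr (Sum.inl a))) (fun l => Sum.inl (Sum.inl (a, some l))) j
    | Sum.inl (Sum.inr b, none) => Sum.inr (Sum.inl (b, none))
    | Sum.inl (Sum.inr b, some j) =>
      Fin.cases (Sum.inl (Sum.inr (Sum.inl b))) (fun l => Sum.inr (Sum.inl (b, some l))) j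
    | Sum.inr (Sum.inl s) => Sum.inl (Sum.inr (Sum.inr s))
    | Sum.inr (Sum.inr s) => Sum.inr (Sum.inr (Sum.inr s))
  let φ : ((A × Option (Fin n)) ⊕ (B ⊕ S₀)) ⊕ ((B × Option (Fin n)) ⊕ (A ⊕ S₁)) →
      ((A ⊕ B) × Option (Fin (n + 1))) ⊕ (S₀ ⊕ S₁) :=
    Sum.elim
      (Sum.elim (fun r => Sum.inl (Sum.inl r.1, r.2.map Fin.succ))
        (Sum.elim (fun b => Sum.inl (Sum.inr b, some 0)) (Sum.inr ∘ Sum.inl)))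
      (Sum.elim (fun r => Sum.inl (Sum.inr r.1, r.2.map Fin.succ))
        (Sum.elim (fun a => Sum.inl (Sum.inl a, some 0)) (Sum.inr ∘ Sum.inr)))
  have hψ : Function.Injective ψ := by
    refine Function.LeftInverse.injective (g := φ) ?_
    rintro (⟨a | b, _ | j⟩ | s | s)
    · rfl
    · induction j using Fin.cases <;> rfl
    · rfl
    · induction j using Fin.cases <;> rfl
    · rfl
    · rfl
  convert (linearIndependent_place h₀ h₁).comp ψ hψ using 1
  funext k
  rcases k with ⟨a | b, _ | j⟩ | s | s
  · exact tan_cons_none (pt x (Sum.inl (Sum.inl a))) (dir x (Sum.inl (Sum.inl a))) 0 1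
  · induction j using Fin.cases with
    | zero => exact tan_cons_zero (pt x (Sum.inl (Sum.inl a))) (dir x (Sum.inl (Sum.inl a))) 0 1
    | succ l => exact tan_cons_succ (pt x (Sum.inl (Sum.inl a))) (dir x (Sum.inl (Sum.inl a))) 0 1 l
  · exact tan_cons_none (pt x (Sum.inl (Sum.inr b))) (dir x (Sum.inl (Sum.inr b))) 1 0
  · induction j using Fin.cases with
    | zero => exact tan_cons_zero (pt x (Sum.inl (Sum.inr b))) (dir x (Sum.inl (Sum.inr b))) 1 0
    | succ l => exact tan_cons_succ (pt x (Sum.inl (Sum.inr b))) (dir x (Sum.inl (Sum.inr b))) 1 0 l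
  · exact seg_cons_single 0 (pt x (Sum.inr (Sum.inl s)))
  · exact seg_cons_single 1 (pt x (Sum.inr (Sum.inr s)))

theorem linearIndependent_gens_lift {F : Type*} [Field F] {A B : Type} [Fintype A] [Fintype B]
    (x : PIdx (A ⊕ B) n → F) (h₀ : LinearIndependent F (gensPts x))
    (h₁ : LinearIndependent F (gensPts (reindex Sum.swap x))) :
    LinearIndependent F (gens (lift (Sum.elim 0 1) x)) := by
  have := linearIndependent_gensPts_lift (S₀ := Empty) (S₁ := Empty)
    (fun r => Sum.elim (fun i => x (i, r.2)) (fun s => s.elim Empty.elim Empty.elim) r.1) ?_ ?_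
  · exact this.comp Sum.inl Sum.inl_injective
  · convert h₀.comp (Sum.map id (Sum.elim id Empty.elim)) ?_ using 1
    · funext k
      rcases k with k | k | k
      · rfl
      · rfl
      · exact k.elim
    · rintro (k | k | k) (l | l | l) <;> simp <;> exact Empty.elim ‹_›
  · convert h₁.comp (Sum.map id (Sum.elim id Empty.elim)) ?_ using 1
    · funext k
      rcases k with k | k | k
      · rfl
      · rfl
      · exact k.elim
    · rintro (k | k | k) (l | l | l) <;> simp <;> exact Empty.elim ‹_›

/-- A form kills the tangent spaces at lifted points as soon as its slices do so. -/
theorem dotProduct_gens_lift {A B : Type} (x : PIdx (A ⊕ B) n → R) (f : Cube (n + 1) → R)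
    (h₀ : ∀ g, slice 0 f ⬝ᵥ gensPts x g = 0)
    (h₁ : ∀ g, slice 1 f ⬝ᵥ gensPts (reindex Sum.swap x) g = 0)
    (g : (A ⊕ B) × Option (Fin (n + 1))) :
    f ⬝ᵥ gens (lift (Sum.elim 0 1) x) g = 0 := by
  rcases g with ⟨a | b, _ | j⟩
  · rw [gens, pt_lift, dir_lift, tan_cons_none, dotProduct_place]
    exact h₀ (Sum.inl (a, none))
  · rw [gens, pt_lift, dir_lift]
    refine Fin.cases ?_ (fun l => ?_) j
    · rw [tan_cons_zero, dotProduct_place]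
      exact h₁ (Sum.inr a)
    · rw [tan_cons_succ, dotProduct_place]
      exact h₀ (Sum.inl (a, some l))
  · rw [gens, pt_lift, dir_lift, tan_cons_none, dotProduct_place]
    exact h₁ (Sum.inl (b, none))
  · rw [gens, pt_lift, dir_lift]
    refine Fin.cases ?_ (fun l => ?_) j
    · rw [tan_cons_zero, dotProduct_place]
      exact h₀ (Sum.inr b)
    · rw [tan_cons_succ, dotProduct_place]
      exact h₁ (Sum.inl (b, some l))

/-- A linearly independent family can be given prescribed values by a functional. -/
theorem exists_dotProduct_eq {F : Type*} [Field F] {κ β : Type*} [Fintype κ] [Fintype β]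
    {v : κ → β → F} (h : LinearIndependent F v) (c : κ → F) : ∃ f : β → F, ∀ k, f ⬝ᵥ v k = c k := by
  classical
  obtain ⟨g, hg⟩ := (Fintype.linearCombination F v).exists_leftInverse_of_injective
    (LinearMap.ker_eq_bot.2 (linearIndependent_iff_injective_fintypeLinearCombination.1 h))
  obtain ⟨f, hf⟩ := (dotProductEquiv F β).surjective ((dotProductEquiv F κ c) ∘ₗ g)
  refine ⟨f, fun k => ?_⟩
  have h1 : g (v k) = Pi.single k 1 := by
    have := LinearMap.congr_fun hg (Pi.single k 1)
    simpa [Fintype.linearCombination_apply_single] using this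
  have h2 := LinearMap.congr_fun hf (v k)
  rw [LinearMap.comp_apply, h1] at h2
  simpa using h2

theorem slice_append (f₀ f₁ : Cube n → R) :
    slice 0 (place 0 f₀ + place 1 f₁) = f₀ ∧ slice 1 (place 0 f₀ + place 1 f₁) = f₁ := by
  constructor <;> funext b <;> simp [slice, place]

theorem det_ne_zero_iff {F : Type*} [Field F] {m : ℕ} (M : Matrix (Fin m) (Fin m) F) :
    M.det ≠ 0 ↔ ∀ v, M *ᵥ v = 0 → v = 0 := by
  rw [Ne, ← Matrix.exists_mulVec_eq_zero_iff]
  push Not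
  exact ⟨fun h v hv => by_contra fun h0 => h v h0 hv, fun h v h0 hv => h0 (h v hv)⟩

end Lift

section Step

/-- A symmetric matrix bordered by a vector that is anisotropic for the inverse form is
nondegenerate. -/
theorem det_bordered_ne_zero {n : ℕ} {H : Matrix (Fin (n + 1)) (Fin (n + 1)) ℂ}
    {H₀ : Matrix (Fin n) (Fin n) ℂ} {g : Fin n → ℂ} (h00 : H 0 0 = 0)
    (h0s : ∀ l, H 0 (Fin.succ l) = g l) (hs0 : ∀ l, H (Fin.succ l) 0 = g l)
    (hss : ∀ j l, H (Fin.succ j) (Fin.succ l) = H₀ j l) (hd : H₀.det ≠ 0)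
    (hg : g ⬝ᵥ H₀⁻¹ *ᵥ g ≠ 0) : H.det ≠ 0 := by
  rw [det_ne_zero_iff]
  intro v hv
  have hu : IsUnit H₀.det := isUnit_iff_ne_zero.2 hd
  have e0 : g ⬝ᵥ Fin.tail v = 0 := by
    have := congrFun hv 0
    simpa [mulVec, dotProduct, Fin.sum_univ_succ, h00, h0s, Fin.tail] using this
  have es : H₀ *ᵥ Fin.tail v = -(v 0) • g := by
    funext j
    have := congrFun hv j.succ
    simp only [mulVec, dotProduct, Fin.sum_univ_succ, hs0, hss, Pi.zero_apply] at this
    simp only [mulVec, dotProduct, Fin.tail, Pi.smul_apply, smul_eq_mul]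
    linear_combination this
  have et : Fin.tail v = -(v 0) • (H₀⁻¹ *ᵥ g) := by
    rw [← mulVec_smul, ← es, mulVec_mulVec, nonsing_inv_mul _ hu, one_mulVec]
  have ev : v 0 = 0 := by
    rw [et, dotProduct_smul, smul_eq_mul] at e0
    simpa [hg] using e0
  rw [ev, neg_zero, zero_smul] at et
  funext j
  induction j using Fin.cases with
  | zero => exact ev
  | succ l => exact congrFun et l

variable {n : ℕ} {κ A B : Type} [Fintype κ] [Fintype A] [Fintype B]

/-- Gluing two general configurations along a new factor. -/
theorem Config.step {i : κ} (h : Config ℂ n κ i) (hA : Fintype.card A + 1 ≤ Fintype.card κ)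
    (hB : Fintype.card B + 1 ≤ Fintype.card κ)
    (h₀ : (Fintype.card A + 1) * (n + 1) + Fintype.card B < 2 ^ n) (m : ℕ) (hmn : m ≤ n)
    (hnm : n < 2 * m)
    (h₁ : Fintype.card B * (n + 1) + (Fintype.card A + 1) + m ≤ 2 ^ n) :
    Config ℂ (n + 1) (Option A ⊕ B) (Sum.inl none) := by
  classical
  have c₀ : Config ℂ n (Option A) none := h.of_card_le (by simpa using hA) none
  obtain ⟨x₁, -, hx₁, -⟩ : Config ℂ n (Option B) none := h.of_card_le (by simpa using hB) none
  let e : (B × Option (Fin n)) ⊕ Option (Fin m) → Option B × Option (Fin n) :=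
    Sum.elim (fun r => (some r.1, r.2)) (fun t => (none, t.map (Fin.castLE hmn)))
  have he : Function.Injective e := by
    rintro (⟨b, o⟩ | t) (⟨b', o'⟩ | t') hh
    · simpa [e] using hh
    · simp [e] at hh
    · simp [e] at hh
    · have := Option.map_injective (Fin.castLE_injective hmn) (Prod.ext_iff.1 hh).2
      rw [this]
  let ρ : Option B ⊕ A → Option A ⊕ B :=
    Sum.elim (fun b => b.elim (Sum.inl none) Sum.inr) (Sum.inl ∘ some)
  have hρ : Function.Injective ρ := by
    rintro ((_ | b) | a) ((_ | b') | a') <;> simp [ρ]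
  obtain ⟨x, ⟨hx0, f₀, hf₀, hd₀⟩, hx1⟩ := ((c₀.generic (T := B) (by simpa using h₀)).and
    ((generic_gensPts (T := A) e he x₁ hx₁ (by
      simp only [Fintype.card_sum, Fintype.card_prod, Fintype.card_option, Fintype.card_fin]
      omega)).reindex ρ hρ)).exists
  set p := pt x (Sum.inl none)
  set q := dir x (Sum.inl none)
  set H₀ := hess f₀ p q
  have hs : H₀⁻¹.IsSymm := by
    have : H₀.IsSymm := by ext j l; exact hess_comm f₀ p q l j
    rw [Matrix.IsSymm, transpose_nonsing_inv, this.eq]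
  have hdi : H₀⁻¹.det ≠ 0 := by
    rw [det_nonsing_inv, Ring.inverse_eq_inv']
    exact inv_ne_zero hd₀
  let Ann : Submodule ℂ (Cube n → ℂ) :=
    LinearMap.ker (Matrix.of (gensPts (reindex Sum.swap x))).mulVecLin
  let grad : (Cube n → ℂ) →ₗ[ℂ] (Fin n → ℂ) :=
    (Matrix.of fun l => tan p q (some l)).mulVecLin
  have hsurj : (Ann.map grad).map (LinearMap.funLeft ℂ ℂ (Fin.castLE hmn)) = ⊤ := by
    rw [eq_top_iff]
    rintro c -
    obtain ⟨f, hf⟩ := exists_dotProduct_eq hx1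
      (Sum.elim (Sum.elim 0 (fun t => t.elim 0 c)) 0)
    refine ⟨grad f, ⟨f, ?_, rfl⟩, ?_⟩
    · refine LinearMap.mem_ker.2 (funext ?_)
      rintro (g | _ | a)
      · exact (dotProduct_comm _ _).trans (hf (Sum.inl (Sum.inl g)))
      · exact (dotProduct_comm _ _).trans (hf (Sum.inl (Sum.inr none)))
      · exact (dotProduct_comm _ _).trans (hf (Sum.inr a))
    · funext t
      exact (dotProduct_comm _ _).trans (hf (Sum.inl (Sum.inr (some t))))
  have hrank : n < 2 * Module.finrank ℂ (Ann.map grad) := by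
    have := Submodule.finrank_map_le (LinearMap.funLeft ℂ ℂ (Fin.castLE hmn)) (Ann.map grad)
    rw [hsurj, finrank_top, Module.finrank_fin_fun] at this
    omega
  obtain ⟨g, ⟨f₁, hf₁, hg⟩, hgM⟩ := exists_quadratic_ne_zero _ hdi hs _ hrank
  obtain ⟨hs0, hs1⟩ := slice_append f₀ f₁
  refine ⟨lift (Sum.elim 0 1) x, place 0 f₀ + place 1 f₁, linearIndependent_gens_lift x hx0 ?_,
    dotProduct_gens_lift x _ (by rwa [hs0]) ?_, ?_⟩
  · let ψ : (B × Option (Fin n)) ⊕ Option A →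
        ((B × Option (Fin n)) ⊕ Option (Fin m)) ⊕ A :=
      Sum.elim (Sum.inl ∘ Sum.inl) (fun a => a.elim (Sum.inl (Sum.inr none)) Sum.inr)
    have hψ : Function.Injective ψ := by
      rintro (g | _ | a) (g' | _ | a') <;> simp [ψ]
    have hk : gensPts (reindex Sum.swap x) = (gensPts (reindex ρ x) ∘ Sum.map e id) ∘ ψ := by
      funext k
      rcases k with k | _ | a <;> rfl
    rw [hk]
    exact hx1.comp ψ hψ
  · intro k
    rw [hs1, dotProduct_comm]
    exact congrFun (LinearMap.mem_ker.1 hf₁) k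
  · have hgl : ∀ l, f₁ ⬝ᵥ tan p q (some l) = g l := by
      intro l
      rw [← hg, dotProduct_comm]
      rfl
    refine det_bordered_ne_zero (H₀ := H₀) (g := g) ?_ ?_ ?_ ?_ hd₀ hgM
    · exact hess_cons_zero_zero p q 0 1 _
    · exact fun l => (hess_cons_zero_succ p q 0 1 _ l).trans (by rw [hs1, hgl])
    · exact fun l => (hess_cons_succ_zero p q 0 1 _ l).trans (by rw [hs1, hgl])
    · exact fun j l => (hess_cons_succ_succ p q 0 1 _ j l).trans (by rw [hs0])

end Step

section DoubleStep

variable {n : ℕ}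

theorem linearIndependent_congr {F M κ : Type*} [Semiring F] [AddCommMonoid M] [Module F M]
    {v w : κ → M} (h : ∀ k, w k = v k) (hv : LinearIndependent F v) : LinearIndependent F w := by
  rwa [funext h]

/-- A form kills tangent spaces and points after lifting as soon as its slices do so. -/
theorem dotProduct_gensPts_lift {R : Type*} [CommRing R] {A B S₀ S₁ : Type}
    (x : PIdx ((A ⊕ B) ⊕ (S₀ ⊕ S₁)) n → R) (f : Cube (n + 1) → R)
    (h₀ : ∀ g, slice 0 f ⬝ᵥ gensPts (reindex (Sum.elim (Sum.inl ∘ Sum.inl)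
      (Sum.elim (Sum.inl ∘ Sum.inr) (Sum.inr ∘ Sum.inl)) : A ⊕ (B ⊕ S₀) → _) x) g = 0)
    (h₁ : ∀ g, slice 1 f ⬝ᵥ gensPts (reindex (Sum.elim (Sum.inl ∘ Sum.inr)
      (Sum.elim (Sum.inl ∘ Sum.inl) (Sum.inr ∘ Sum.inr)) : B ⊕ (A ⊕ S₁) → _) x) g = 0)
    (g : ((A ⊕ B) × Option (Fin (n + 1))) ⊕ (S₀ ⊕ S₁)) :
    f ⬝ᵥ gensPts (lift (Sum.elim (Sum.elim 0 1) (Sum.elim 0 1)) x) g = 0 := by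
  rcases g with g | s | s
  · exact dotProduct_gens_lift (reindex Sum.inl x) f
      (Sum.rec (fun g => h₀ (Sum.inl g)) (fun b => h₀ (Sum.inr (Sum.inl b))))
      (Sum.rec (fun g => h₁ (Sum.inl g)) (fun b => h₁ (Sum.inr (Sum.inl b)))) g
  · refine (congrArg (f ⬝ᵥ ·) (seg_cons_single 0 (pt x (Sum.inr (Sum.inl s))))).trans ?_
    rw [dotProduct_place]
    exact h₀ (Sum.inr (Sum.inr s))
  · refine (congrArg (f ⬝ᵥ ·) (seg_cons_single 1 (pt x (Sum.inr (Sum.inr s))))).trans ?_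
    rw [dotProduct_place]
    exact h₁ (Sum.inr (Sum.inr s))

theorem reindex_swap_lift {R : Type*} [CommRing R] {P : Type}
    (x : PIdx ((P ⊕ P) ⊕ (P ⊕ P)) n → R) :
    reindex Sum.swap (lift (Sum.elim (Sum.elim 0 1) (Sum.elim 0 1)) x) =
      lift (Sum.elim (Sum.elim 0 1) (Sum.elim 0 1)) (reindex Sum.swap x) := by
  funext r
  obtain ⟨(i | i) | (i | i), r⟩ := r <;> rfl

/-- Gluing four general configurations along two new factors. -/
theorem Config.double_step {P : Type} [Fintype P] {i : P} (h : Config ℂ n P i)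
    (hc : Fintype.card P * (n + 3) < 2 ^ n) :
    Config ℂ (n + 2) ((P ⊕ P) ⊕ (P ⊕ P)) (Sum.inl (Sum.inl i)) := by
  classical
  obtain ⟨x₀, -, hx₀, -⟩ := id h
  have hc' : Fintype.card P * (n + 1) + (Fintype.card P + Fintype.card P) < 2 ^ n := by
    linarith
  have hg := generic_gensPts (T := P ⊕ P) id Function.injective_id x₀ hx₀ (by
    simp only [Fintype.card_sum, Fintype.card_prod, Fintype.card_option, Fintype.card_fin]
    omega)
  have hg' := generic_gensPts (T := (P ⊕ P) ⊕ Unit) id Function.injective_id x₀ hx₀ (by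
    simp only [Fintype.card_sum, Fintype.card_prod, Fintype.card_option, Fintype.card_fin,
      Fintype.card_unit]
    omega)
  simp only [Sum.map_id_id, Function.comp_id] at hg hg'
  obtain ⟨x, ⟨⟨⟨h00, f₀, hf₀, hd⟩, h01⟩, h10⟩, h11⟩ :=
    ((((h.generic (T := P ⊕ P) (by simpa using hc')).reindex
      (Sum.elim (Sum.inl ∘ Sum.inl) (Sum.elim (Sum.inl ∘ Sum.inr) (Sum.inr ∘ Sum.inl)) :
        P ⊕ (P ⊕ P) → (P ⊕ P) ⊕ (P ⊕ P)) (by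
          rintro (a | a | a) (b | b | b) <;> simp)).and
    (hg.reindex (Sum.elim (Sum.inl ∘ Sum.inr) (Sum.elim (Sum.inl ∘ Sum.inl) (Sum.inr ∘ Sum.inr)) :
        P ⊕ (P ⊕ P) → (P ⊕ P) ⊕ (P ⊕ P)) (by
          rintro (a | a | a) (b | b | b) <;> simp))).and
    (hg.reindex (Sum.elim (Sum.inr ∘ Sum.inl) (Sum.elim (Sum.inr ∘ Sum.inr) (Sum.inl ∘ Sum.inl)) :
        P ⊕ (P ⊕ P) → (P ⊕ P) ⊕ (P ⊕ P)) (by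
          rintro (a | a | a) (b | b | b) <;> simp))).and
    (hg'.reindex (Sum.elim (Sum.inr ∘ Sum.inr) (Sum.elim (Sum.elim (Sum.inr ∘ Sum.inl)
        (Sum.inl ∘ Sum.inr)) (fun _ => Sum.inl (Sum.inl i))) :
        P ⊕ ((P ⊕ P) ⊕ Unit) → (P ⊕ P) ⊕ (P ⊕ P)) (by
          rintro (a | (a | a) | a) (b | (b | b) | b) <;> simp)) |>.exists
  obtain ⟨f₁, hf₁⟩ := exists_dotProduct_eq h11 (Sum.elim 0 (Sum.elim 0 1))
  have hf₁' : ∀ g, f₁ ⬝ᵥ gensPts (reindex (Sum.elim (Sum.inr ∘ Sum.inr)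
      (Sum.elim (Sum.inr ∘ Sum.inl) (Sum.inl ∘ Sum.inr)) :
        P ⊕ (P ⊕ P) → (P ⊕ P) ⊕ (P ⊕ P)) x) g = 0 := by
    rintro (g | a | a)
    · exact hf₁ (Sum.inl g)
    · exact hf₁ (Sum.inr (Sum.inl (Sum.inl a)))
    · exact hf₁ (Sum.inr (Sum.inl (Sum.inr a)))
  have h11' : LinearIndependent ℂ (gensPts (reindex (Sum.elim (Sum.inr ∘ Sum.inr)
      (Sum.elim (Sum.inr ∘ Sum.inl) (Sum.inl ∘ Sum.inr)) :
        P ⊕ (P ⊕ P) → (P ⊕ P) ⊕ (P ⊕ P)) x)) := by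
    have := h11.comp (Sum.map id Sum.inl) (Function.injective_id.sumMap Sum.inl_injective)
    refine linearIndependent_congr (fun k => ?_) this
    rcases k with k | a | a <;> rfl
  set p := pt x (Sum.inl (Sum.inl i))
  set q := dir x (Sum.inl (Sum.inl i))
  have hp : f₁ ⬝ᵥ seg p = 1 := hf₁ (Sum.inr (Sum.inr ()))
  obtain ⟨hs0, hs1⟩ := slice_append (place 0 f₀) (place 1 f₁)
  have slices (e e' : Fin 2) (u : Cube n → ℂ) (g : Cube n → ℂ) :
      slice e' (place e u) ⬝ᵥ g = if e' = e then u ⬝ᵥ g else 0 := by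
    rw [slice_place]; split_ifs <;> simp
  refine ⟨lift (Sum.elim 0 1) (lift (Sum.elim (Sum.elim 0 1) (Sum.elim 0 1)) x),
    place 0 (place 0 f₀) + place 1 (place 1 f₁), linearIndependent_gens_lift _
      (linearIndependent_gensPts_lift x h00 h01) ?_, dotProduct_gens_lift _ _ ?_ ?_, ?_⟩
  · rw [reindex_swap_lift]
    refine linearIndependent_gensPts_lift _ ?_ ?_
    · exact linearIndependent_congr (fun k => by rcases k with k | a | a <;> rfl) h10
    · exact linearIndependent_congr (fun k => by rcases k with k | a | a <;> rfl) h11'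
  · rw [hs0]
    refine dotProduct_gensPts_lift x _ (fun g => ?_) (fun g => ?_)
    · rw [slices]; exact hf₀ g
    · rw [slices]; rfl
  · rw [hs1, reindex_swap_lift]
    refine dotProduct_gensPts_lift _ _ (fun g => ?_) (fun g => ?_)
    · rw [slices]; rfl
    · rw [slices]
      refine Eq.trans ?_ (hf₁' g)
      rcases g with g | a | a <;> rfl
  · set p' : Fin (n + 1) → Fin 2 → ℂ := Fin.cons (Pi.single 0 1) p
    set q' : Fin (n + 1) → Fin 2 → ℂ := Fin.cons (Pi.single 1 1) q
    change (hess (place 0 (place 0 f₀) + place 1 (place 1 f₁))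
      (Fin.cons (Pi.single 0 1) p') (Fin.cons (Pi.single 1 1) q')).det ≠ 0
    set H := hess (place 0 (place 0 f₀) + place 1 (place 1 f₁))
      (Fin.cons (Pi.single 0 1) p') (Fin.cons (Pi.single 1 1) q')
    have e00 : H 0 0 = 0 := hess_cons_zero_zero p' q' 0 1 _
    have e01 : H 0 (Fin.succ 0) = 1 := (hess_cons_zero_succ p' q' 0 1 _ 0).trans (by
      rw [hs1, tan_cons_zero, dotProduct_place, slices, if_pos rfl, hp])
    have e0s : ∀ l : Fin n, H 0 l.succ.succ = 0 := fun l =>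
      (hess_cons_zero_succ p' q' 0 1 _ l.succ).trans (by
        rw [hs1, tan_cons_succ, dotProduct_place, slices, if_neg (by decide)])
    have e11 : H (Fin.succ 0) (Fin.succ 0) = 0 := by simp [H, hess]
    have e1s : ∀ l : Fin n, H (Fin.succ 0) l.succ.succ = 0 := fun l =>
      (hess_cons_succ_succ p' q' 0 1 _ 0 l.succ).trans (by
        rw [hs0, hess_cons_zero_succ, slices, if_neg (by decide)])
    have ess : ∀ j l : Fin n, H j.succ.succ l.succ.succ = hess f₀ p q j l := fun j l =>
      (hess_cons_succ_succ p' q' 0 1 _ j.succ l.succ).trans (by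
        rw [hs0, hess_cons_succ_succ, slice_place, if_pos rfl])
    have hsymm : ∀ j l, H j l = H l j := hess_comm _ _ _
    rw [det_ne_zero_iff]
    intro v hv
    have r0 : v (Fin.succ 0) = 0 := by
      have := congrFun hv 0
      rw [mulVec, dotProduct, Fin.sum_univ_succ, Fin.sum_univ_succ] at this
      simpa only [e00, e01, e0s, zero_mul, Finset.sum_const_zero, zero_add, add_zero, one_mul,
        Pi.zero_apply] using this
    have r1 : v 0 = 0 := by
      have := congrFun hv (Fin.succ 0)
      rw [mulVec, dotProduct, Fin.sum_univ_succ, Fin.sum_univ_succ, hsymm] at this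
      simpa only [e11, e01, e1s, zero_mul, Finset.sum_const_zero, zero_add, add_zero, one_mul,
        Pi.zero_apply] using this
    have rs : (fun l : Fin n => v l.succ.succ) = 0 := by
      refine (det_ne_zero_iff _).1 hd _ (funext fun j => ?_)
      have := congrFun hv j.succ.succ
      rw [mulVec, dotProduct, Fin.sum_univ_succ, Fin.sum_univ_succ, r0, r1] at this
      simp only [ess, mul_zero, zero_add] at this
      exact this
    funext j
    induction j using Fin.cases with
    | zero => exact r1
    | succ j =>
      induction j using Fin.cases with
      | zero => exact r0
      | succ l => exact congrFun rs l

end DoubleStep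

section Induction

theorem Config.step_of_half {n b c : ℕ} {i : Fin (4095 * 2 ^ (n - 12) / (n + 1))} (hn : 14 ≤ n)
    (h : Config ℂ n (Fin (4095 * 2 ^ (n - 12) / (n + 1))) i)
    (hbc : b ≤ c) (hcb : c ≤ b + 1) (hnb : n + 1 ≤ b)
    (hlow : (b + c) * (n + 2) ≤ 4095 * 2 ^ (n - 11))
    (hsize : n = 14 ∧ b + c = 2047 ∨ n < 2 ^ (n - 11)) (k : ℕ) (j : Fin k) (hk : k ≤ b + c) :
    Config ℂ (n + 1) (Fin k) j := by
  obtain ⟨a, rfl⟩ : ∃ a, c = a + 1 := ⟨c - 1, by omega⟩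
  have h11 : 2 ^ (n - 11) = 2 * 2 ^ (n - 12) := by
    rw [← pow_succ']; congr 1; omega
  have h0 : 2 ^ n = 4096 * 2 ^ (n - 12) := by
    rw [show (4096 : ℕ) = 2 ^ 12 by norm_num, ← pow_add]; congr 1; omega
  have key : (a + 1) * (n + 1) + b < 2 ^ n ∧
      b * (n + 1) + (a + 1) + (n / 2 + 1) ≤ 2 ^ n ∧ (a + 1) * (n + 1) ≤ 4095 * 2 ^ (n - 12) ∧
      (b + 1) * (n + 1) ≤ 4095 * 2 ^ (n - 12) := by
    rcases hsize with ⟨rfl, hs⟩ | hs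
    · norm_num
      omega
    · rw [h0]
      rw [h11] at hlow hs
      obtain rfl | rfl : b = a ∨ b = a + 1 := by omega
      · refine ⟨?_, ?_, ?_, ?_⟩ <;> ring_nf at hlow ⊢ <;> omega
      · refine ⟨?_, ?_, ?_, ?_⟩ <;> ring_nf at hlow ⊢ <;> omega
  obtain ⟨k1, k2, k3, k4⟩ := key
  have := h.step (A := Fin a) (B := Fin b)
    (by simpa using (Nat.le_div_iff_mul_le (by omega)).2 k3)
    (by simpa using (Nat.le_div_iff_mul_le (by omega)).2 k4)
    (by simpa using k1) (n / 2 + 1) (by omega) (by omega) (by simpa using k2)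
  refine this.of_card_le ?_ j
  simp only [Fintype.card_fin, Fintype.card_sum, Fintype.card_option]
  omega

theorem config_of_base (h12 : Config ℂ 12 (Fin 315) 0) (h13 : Config ℂ 13 (Fin 585) 0)
    (n : ℕ) (hn : 12 ≤ n) : ∀ (k : ℕ) (j : Fin k), k * (n + 1) ≤ 4095 * 2 ^ (n - 12) →
      Config ℂ n (Fin k) j := by
  rcases (by omega : n = 12 ∨ n = 13 ∨ 14 ≤ n) with rfl | rfl | h14
  · intro k j hk
    exact h12.of_card_le (by simp; omega) j
  · intro k j hk
    exact h13.of_card_le (by simp; omega) j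
  clear hn
  induction n, h14 using Nat.le_induction with
  | base =>
    intro k j hk
    refine Config.of_card_le (Config.double_step (P := Fin 273) (i := 0)
      (h12.of_card_le (by simp) 0) (by simp)) ?_ j
    simp
    omega
  | succ n hn ih =>
    intro k j hk
    have ih := ih (4095 * 2 ^ (n - 12) / (n + 1))
    have hpow : (n + 2) ^ 2 ≤ 1000 * 2 ^ (n - 11) := by
      clear * - hn
      induction n, hn using Nat.le_induction with
      | base => norm_num
      | succ n hn ih =>
        rw [show n + 1 - 11 = n - 11 + 1 by omega, pow_succ 2]
        nlinarith
    rw [show n + 1 - 12 = n - 11 by omega] at hk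
    set K := 4095 * 2 ^ (n - 11) / (n + 2) with hK
    have hkK : k ≤ K := (Nat.le_div_iff_mul_le (by omega)).2 hk
    have hKb : K * (n + 2) ≤ 4095 * 2 ^ (n - 11) := Nat.div_mul_le_self _ _
    have hKn : 2 * (n + 2) ≤ K := (Nat.le_div_iff_mul_le (by omega)).2 (by nlinarith)
    have hpos : 0 < 4095 * 2 ^ (n - 12) / (n + 1) := by
      refine Nat.div_pos ?_ (by omega)
      have : 2 ^ (n - 11) = 2 * 2 ^ (n - 12) := by
        rw [← pow_succ']; congr 1; omega
      nlinarith
    refine Config.step_of_half (b := K / 2) (c := (K + 1) / 2) hn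
      (ih ⟨0, hpos⟩ (Nat.div_mul_le_self _ _)) (by omega) (by omega) (by omega) ?_ ?_ k j (by omega)
    · rwa [show K / 2 + (K + 1) / 2 = K by omega]
    · rcases (by omega : n = 14 ∨ 15 ≤ n) with rfl | h15
      · left
        norm_num at hK
        omega
      · right
        clear * - h15
        induction n, h15 using Nat.le_induction with
        | base => norm_num
        | succ n hn ih =>
          rw [show n + 1 - 11 = n - 11 + 1 by omega, pow_succ]
          omega

end Induction

section Elimination

/-- Derivations of a polynomial ring with values in a formally étale algebra extend to it. -/
theorem exists_derivation {σ E : Type*} [Field E] [Algebra ℂ E] [Algebra (MvPolynomial σ ℂ) E]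
    [IsScalarTower ℂ (MvPolynomial σ ℂ) E] [Algebra.FormallyEtale (MvPolynomial σ ℂ) E]
    (v : σ → E) :
    ∃ D : Derivation ℂ E E, ∀ s, D (algebraMap (MvPolynomial σ ℂ) E (MvPolynomial.X s)) = v s := by
  let D₀ : Derivation ℂ (MvPolynomial σ ℂ) E := MvPolynomial.mkDerivation ℂ v
  let ℓ : Ω[E⁄ℂ] →ₗ[E] E :=
    (LinearMap.liftBaseChange E D₀.liftKaehlerDifferential) ∘ₗ
      (KaehlerDifferential.tensorKaehlerEquivOfFormallyEtale ℂ (MvPolynomial σ ℂ) E).symm.toLinearMap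
  refine ⟨ℓ.compDer (KaehlerDifferential.D ℂ E), fun s => ?_⟩
  have := KaehlerDifferential.tensorKaehlerEquivOfFormallyEtale_symm_D_algebraMap ℂ
    (MvPolynomial σ ℂ) E (MvPolynomial.X s)
  change ℓ (KaehlerDifferential.D ℂ E _) = v s
  simp only [ℓ, LinearMap.comp_apply, LinearEquiv.coe_coe, this]
  simp [D₀]

/-- A polynomial system with parameters which has no solution over fields of algebraic functions of
the parameters has no solution for general values of the parameters. -/
theorem generic_no_solution {σ τ : Type} [Finite τ]
    (S : Set (MvPolynomial τ (MvPolynomial σ ℂ)))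
    (H : ∀ (E : Type) [Field E] [Algebra ℂ E] (φ : MvPolynomial σ ℂ →ₐ[ℂ] E),
      Function.Injective φ → (∀ v : σ → E, ∃ D : Derivation ℂ E E, ∀ s, D (φ (.X s)) = v s) →
      ∀ t : τ → E, ∃ P ∈ S, MvPolynomial.eval₂ (φ : MvPolynomial σ ℂ →+* E) t P ≠ 0) :
    Generic fun y : σ → ℂ => ∀ t : τ → ℂ, ∃ P ∈ S,
      MvPolynomial.eval₂ (MvPolynomial.eval y) t P ≠ 0 := by
  let A := MvPolynomial σ ℂ
  let K := FractionRing A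
  let B := MvPolynomial τ A
  let BK := MvPolynomial τ K
  let : Algebra B BK := MvPolynomial.algebraMvPolynomial
  have top : Ideal.map (algebraMap B BK) (Ideal.span S) = ⊤ := by
    by_contra hne
    obtain ⟨m, hm, hIm⟩ := Ideal.exists_le_maximal _ hne
    let : Field (BK ⧸ m) := Ideal.Quotient.field m
    have : Module.Finite K (BK ⧸ m) := finite_of_finite_type_of_isJacobsonRing K (BK ⧸ m)
    have : Algebra.IsSeparable K (BK ⧸ m) := inferInstance
    have : Algebra.FormallyEtale K (BK ⧸ m) := Algebra.FormallyEtale.of_isSeparable _ _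
    have : Algebra.FormallyEtale A K :=
      Algebra.FormallyEtale.of_isLocalization (nonZeroDivisors A)
    have : Algebra.FormallyEtale A (BK ⧸ m) := Algebra.FormallyEtale.comp A K (BK ⧸ m)
    obtain ⟨P, hP, hne⟩ := H (BK ⧸ m) (IsScalarTower.toAlgHom ℂ A (BK ⧸ m)) (by
        change Function.Injective (algebraMap A (BK ⧸ m))
        rw [IsScalarTower.algebraMap_eq A K (BK ⧸ m)]
        exact (algebraMap K (BK ⧸ m)).injective.comp (IsFractionRing.injective A K))
      (fun v => exists_derivation v) (fun s => Ideal.Quotient.mk m (.X s))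
    refine hne ?_
    have h0 : Ideal.Quotient.mk m (algebraMap B BK P) = 0 :=
      Ideal.Quotient.eq_zero_iff_mem.2 (hIm (Ideal.mem_map_of_mem _ (Ideal.subset_span hP)))
    rw [← h0]
    have hom : MvPolynomial.eval₂Hom (algebraMap A (BK ⧸ m))
        (fun s => Ideal.Quotient.mk m (.X s)) =
        (Ideal.Quotient.mk m).comp (algebraMap B BK) := by
      refine MvPolynomial.ringHom_ext (fun a => ?_) (fun s => ?_)
      · rw [MvPolynomial.eval₂Hom_C, RingHom.comp_apply, MvPolynomial.algebraMap_def,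
          MvPolynomial.map_C]
        rfl
      · rw [MvPolynomial.eval₂Hom_X', RingHom.comp_apply, MvPolynomial.algebraMap_def,
          MvPolynomial.map_X]
    exact RingHom.congr_fun hom P
  have h1 : (1 : BK) ∈ Ideal.map (algebraMap B BK) (Ideal.span S) := by rw [top]; trivial
  obtain ⟨⟨⟨Q, hQ⟩, ⟨_, F, hF, rfl⟩⟩, hx⟩ :=
    (IsLocalization.mem_map_algebraMap_iff ((nonZeroDivisors A).map (MvPolynomial.C (σ := τ)))
      BK).1 h1
  rw [one_mul] at hx
  have hinj : Function.Injective (algebraMap B BK) :=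
    MvPolynomial.map_injective _ (IsFractionRing.injective A K)
  have hCF : MvPolynomial.C F ∈ Ideal.span S := by
    have := hinj hx
    simp only at this
    rw [this]
    exact hQ
  refine ⟨F, nonZeroDivisors.ne_zero hF, fun y hy t => ?_⟩
  by_contra! h
  refine hy ?_
  have : Ideal.span S ≤ RingHom.ker (MvPolynomial.eval₂Hom (MvPolynomial.eval y) t) :=
    Ideal.span_le.2 fun P hP => h P hP
  simpa using this hCF

end Elimination

section Tangency

variable {E : Type*} [Field E] {n : ℕ}

theorem seg_update_apply (p : Fin n → Fin 2 → E) (j : Fin n) (u : Fin 2 → E) (b : Cube n) :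
    seg (Function.update p j u) b = u (b j) * ∏ l ∈ Finset.univ.erase j, p l (b l) := by
  rw [seg, ← Finset.mul_prod_erase _ _ (Finset.mem_univ j), Function.update_self]
  congr 1
  refine Finset.prod_congr rfl fun l hl => ?_
  rw [Function.update_of_ne (Finset.ne_of_mem_erase hl)]

theorem seg_update_add (p : Fin n → Fin 2 → E) (j : Fin n) (u v : Fin 2 → E) :
    seg (Function.update p j (u + v)) =
      seg (Function.update p j u) + seg (Function.update p j v) := by
  funext b
  simp only [seg_update_apply, Pi.add_apply, add_mul]

theorem seg_update_smul (p : Fin n → Fin 2 → E) (j : Fin n) (a : E) (u : Fin 2 → E) :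
    seg (Function.update p j (a • u)) = a • seg (Function.update p j u) := by
  funext b
  simp only [seg_update_apply, Pi.smul_apply, smul_eq_mul, mul_assoc]

theorem seg_update_zero (p : Fin n → Fin 2 → E) (j : Fin n) :
    seg (Function.update p j 0) = 0 := by
  have := seg_update_smul p j 0 0
  rwa [zero_smul, zero_smul] at this

theorem exists_complement {v : Fin 2 → E} (hv : v ≠ 0) :
    ∃ u : Fin 2 → E, ∀ x : Fin 2 → E, ∃ a b : E, x = a • v + b • u := by
  by_cases h0 : v 0 = 0
  · have h1 : v 1 ≠ 0 := fun h1 => hv (by funext s; fin_cases s <;> assumption)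
    refine ⟨Pi.single 0 1, fun x => ⟨x 1 / v 1, x 0, ?_⟩⟩
    funext s
    fin_cases s <;> simp [h0, h1]
  · refine ⟨Pi.single 1 1, fun x => ⟨x 0 / v 0, x 1 - x 0 / v 0 * v 1, ?_⟩⟩
    funext s
    fin_cases s <;> simp [h0]

variable [Algebra ℂ E] (D : Derivation ℂ E E)

theorem derivation_prod {n : ℕ} (g : Fin n → E) :
    D (∏ l, g l) = ∑ j, ∏ l, Function.update g j (D (g j)) l := by
  induction n with
  | zero => simp
  | succ n ih =>
    have h0 : ∀ j : Fin n, Function.update g j.succ (D (g j.succ)) 0 = g 0 := fun j =>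
      Function.update_of_ne (Fin.succ_ne_zero j).symm _ _
    have hs : ∀ j l : Fin n, Function.update g j.succ (D (g j.succ)) l.succ =
        Function.update (fun l => g l.succ) j (D (g j.succ)) l := fun j l =>
      (Function.update_comp_eq_of_injective' g (Fin.succ_injective n) j _).symm ▸ rfl
    rw [Fin.prod_univ_succ, Derivation.leibniz, ih, Fin.sum_univ_succ, Fin.prod_univ_succ,
      Function.update_self, smul_eq_mul, smul_eq_mul, add_comm, Finset.mul_sum]
    congr 1
    · rw [mul_comm]
      rfl
    · refine Finset.sum_congr rfl fun j _ => ?_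
      rw [Fin.prod_univ_succ, h0]
      simp only [hs]

theorem derivation_seg (p : Fin n → Fin 2 → E) :
    (fun b => D (seg p b)) = ∑ j, seg (Function.update p j fun s => D (p j s)) := by
  funext b
  rw [seg, derivation_prod, Finset.sum_apply]
  refine Finset.sum_congr rfl fun j _ => Finset.prod_congr rfl fun l _ => ?_
  by_cases h : l = j
  · subst h; simp
  · rw [Function.update_of_ne h, Function.update_of_ne h]

theorem derivation_seg_eq_zero {p : Fin n → Fin 2 → E} (hp : ∀ l s, D (p l s) = 0) :
    (fun b => D (seg p b)) = 0 := by
  rw [derivation_seg]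
  refine Finset.sum_eq_zero fun j _ => ?_
  rw [show (fun s => D (p j s)) = 0 from funext (hp j), seg_update_zero]

theorem derivation_seg_eq {p : Fin n → Fin 2 → E} {j : Fin n} {v : Fin 2 → E}
    (hj : ∀ s, D (p j s) = v s) (hp : ∀ l, l ≠ j → ∀ s, D (p l s) = 0) :
    (fun b => D (seg p b)) = seg (Function.update p j v) := by
  rw [derivation_seg, Finset.sum_eq_single j]
  · rw [show (fun s => D (p j s)) = v from funext hj]
  · intro l _ hl
    rw [show (fun s => D (p l s)) = 0 from funext (hp l hl), seg_update_zero]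
  · simp

theorem derivation_tan_eq_zero {p q : Fin n → Fin 2 → E} (hp : ∀ l s, D (p l s) = 0)
    (hq : ∀ l s, D (q l s) = 0) (o : Option (Fin n)) : (fun b => D (tan p q o b)) = 0 := by
  cases o with
  | none => exact derivation_seg_eq_zero D hp
  | some j =>
    refine derivation_seg_eq_zero D fun l s => ?_
    by_cases h : l = j
    · subst h; simpa using hq l s
    · rw [Function.update_of_ne h]; exact hp l s

theorem derivation_tan_some {p q : Fin n → Fin 2 → E} {j : Fin n}
    (hj : ∀ s, D (p j s) = q j s) (hp : ∀ l, l ≠ j → ∀ s, D (p l s) = 0)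
    (hq : ∀ l s, D (q l s) = 0) (l : Fin n) :
    (fun b => D (tan p q (some l) b)) = if l = j then 0 else tan₂ p q l j := by
  split_ifs with h
  · subst h
    refine derivation_seg_eq_zero D fun m s => ?_
    by_cases h : m = l
    · subst h; simpa using hq m s
    · rw [Function.update_of_ne h]; exact hp m h s
  · refine derivation_seg_eq D (fun s => ?_) fun m hm s => ?_
    · rw [Function.update_of_ne (Ne.symm h)]; exact hj s
    · by_cases hml : m = l
      · subst hml; simpa using hq m s
      · rw [Function.update_of_ne hml]; exact hp m hm s

end Tangency

section Tangency

variable {E : Type*} [Field E] [Algebra ℂ E] {n : ℕ} {ι T : Type} [Fintype ι] [Fintype T]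

theorem derivation_sum_smul {κ β : Type*} [Fintype κ] (D : Derivation ℂ E E) (a : κ → E)
    (v : κ → β → E) : (fun b => D ((∑ g, a g • v g) b)) =
      ∑ g, D (a g) • v g + ∑ g, a g • fun b => D (v g b) := by
  funext b
  simp only [Finset.sum_apply, Pi.smul_apply, smul_eq_mul, map_sum, Derivation.leibniz,
    Pi.add_apply, Finset.sum_add_distrib]
  rw [add_comm]
  simp only [mul_comm]

/-- Generators of the span of tangent spaces and further vectors. -/
def tanVecs {R : Type*} [CommRing R] (p q : ι → Fin n → Fin 2 → R) (c : T → Cube n → R) :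
    (ι × Option (Fin n)) ⊕ T → Cube n → R :=
  Sum.elim (fun g => tan (p g.1) (q g.1) g.2) c

variable {p q : ι → Fin n → Fin 2 → E} {c : T → Cube n → E}

/-- Two points whose span contains infinitesimally close decomposable tensors do not exist. -/
theorem eq_smul_of_eq_sum (hn : 0 < n) (hV : LinearIndependent E (tanVecs p q c))
    (hDp : ∀ i j, ∃ D : Derivation ℂ E E, (∀ s, D (p i j s) = q i j s) ∧
      (∀ l, l ≠ j → ∀ s, D (p i l s) = 0) ∧ (∀ i', i' ≠ i → ∀ l s, D (p i' l s) = 0))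
    (w : Fin n → Fin 2 → E) (a : ι → E) (hw : seg w = ∑ i, a i • seg (p i)) (i₀ : ι) :
    ∃ (i : ι) (α : E), seg w = α • seg (p i) := by
  classical
  by_cases hw0 : seg w = 0
  · exact ⟨i₀, 0, by rw [hw0, zero_smul]⟩
  by_cases huniq : ∃ i, ∀ i', i' ≠ i → a i' = 0
  · obtain ⟨i, hi⟩ := huniq
    refine ⟨i, a i, hw.trans (Finset.sum_eq_single i (fun i' _ h => ?_) (by simp))⟩
    rw [hi i' h, zero_smul]
  exfalso
  push Not at huniq
  obtain ⟨i₁, -, h₁⟩ := huniq i₀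
  obtain ⟨i₂, h₁₂, h₂⟩ := huniq i₁
  have hwj : ∀ j, w j ≠ 0 := by
    intro j hj
    refine hw0 ?_
    rw [← Function.update_eq_self j w, hj, seg_update_zero]
  choose u hu using fun j => exists_complement (hwj j)
  let I : Bool → ι := fun s => if s then i₁ else i₂
  have hI : ∀ s, a (I s) ≠ 0 := by rintro (_ | _) <;> simpa [I]
  have hIinj : Function.Injective I := by
    rintro (_ | _) (_ | _) h <;> simp_all [I]
  choose D hDj hDl hDi using fun s : Bool => hDp (I s)
  have hD : ∀ s j, (fun b => D s j (seg w b)) =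
      ∑ i, D s j (a i) • seg (p i) + a (I s) • tan (p (I s)) (q (I s)) (some j) := by
    intro s j
    rw [hw, derivation_sum_smul]
    refine congrArg (_ + ·) ((Finset.sum_eq_single (I s) ?_ (by simp)).trans ?_)
    · intro i _ h
      rw [derivation_seg_eq_zero _ (hDi s j i h), smul_zero]
    · rw [derivation_seg_eq _ (hDj s j) (hDl s j)]; rfl
  let x : Option (Bool × Fin n) → Cube n → E :=
    fun o => o.elim (seg w) fun r b => D r.1 r.2 (seg w b)
  have hx : LinearIndependent E x := by
    rw [Fintype.linearIndependent_iff]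
    intro μ hμ
    rw [Fintype.sum_option] at hμ
    have hμs : ∀ r : Bool × Fin n, μ (some r) = 0 := by
      intro r
      obtain ⟨h, hh⟩ := exists_dotProduct_eq hV (Pi.single (Sum.inl (I r.1, some r.2)) 1)
      have hnone : ∀ i, h ⬝ᵥ seg (p i) = 0 := fun i =>
        (hh (Sum.inl (i, none))).trans (by simp)
      have hsome : ∀ r' : Bool × Fin n, h ⬝ᵥ tan (p (I r'.1)) (q (I r'.1)) (some r'.2) =
          if r' = r then 1 else 0 := fun r' =>
        (hh (Sum.inl (I r'.1, some r'.2))).trans (by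
          simp [Pi.single_apply, Prod.ext_iff, hIinj.eq_iff])
      have hxn : h ⬝ᵥ x none = 0 := by
        change h ⬝ᵥ seg w = 0
        rw [hw, dotProduct_sum]
        simp [hnone]
      have hxs : ∀ r' : Bool × Fin n, h ⬝ᵥ x (some r') = if r' = r then a (I r.1) else 0 := by
        intro r'
        change h ⬝ᵥ (fun b => D r'.1 r'.2 (seg w b)) = _
        rw [hD, dotProduct_add, dotProduct_sum, dotProduct_smul, hsome]
        split_ifs with hr
        · subst hr; simp [hnone]
        · simp [hnone]
      have := congrArg (h ⬝ᵥ ·) hμ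
      simp only [dotProduct_add, dotProduct_smul, dotProduct_sum, hxn, hxs, dotProduct_zero,
        zero_add, smul_eq_mul, mul_ite, mul_zero, Finset.sum_ite_eq',
        Finset.mem_univ, if_true] at this
      exact (mul_eq_zero.1 this).resolve_right (hI _)
    rintro (_ | r)
    · simp only [hμs, zero_smul, Finset.sum_const_zero, add_zero] at hμ
      exact (smul_eq_zero.1 hμ).resolve_right hw0
    · exact hμs r
  have hupd : ∀ j v, seg (Function.update w j v) ∈ Submodule.span E (Set.range (tan w u)) := by
    intro j v
    obtain ⟨α, β, rfl⟩ := hu j v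
    rw [seg_update_add, seg_update_smul, seg_update_smul, Function.update_eq_self]
    exact add_mem (Submodule.smul_mem _ _ (Submodule.subset_span ⟨none, rfl⟩))
      (Submodule.smul_mem _ _ (Submodule.subset_span ⟨some j, rfl⟩))
  have hmem : ∀ o, x o ∈ Submodule.span E (Set.range (tan w u)) := by
    rintro (_ | r)
    · exact Submodule.subset_span ⟨none, rfl⟩
    · change (fun b => D r.1 r.2 (seg w b)) ∈ _
      rw [derivation_seg]
      exact Submodule.sum_mem _ fun j _ => hupd j _
  have hcard := (LinearIndependent.of_comp (Submodule.subtype _)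
    (v := fun o => (⟨x o, hmem o⟩ : Submodule.span E (Set.range (tan w u)))) hx
    ).fintype_card_le_finrank
  have := hcard.trans (finrank_range_le_card (R := E) (tan w u))
  simp only [Fintype.card_option, Fintype.card_prod, Fintype.card_bool, Fintype.card_fin] at this
  omega

/-- A decomposable tensor defined over a differential field, whose tangent space lies in the span of
the tangent spaces at general points and further general vectors, is one of these points. -/
theorem eq_smul_of_tangent_le (hn : 0 < n) (hV : LinearIndependent E (tanVecs p q c))
    (hf : ∀ i, ∃ f, (∀ g, f ⬝ᵥ tanVecs p q c g = 0) ∧ (hess f (p i) (q i)).det ≠ 0)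
    (hDp : ∀ i j, ∃ D : Derivation ℂ E E, (∀ s, D (p i j s) = q i j s) ∧
      (∀ l, l ≠ j → ∀ s, D (p i l s) = 0) ∧ (∀ i', i' ≠ i → ∀ l s, D (p i' l s) = 0) ∧
      (∀ i' l s, D (q i' l s) = 0) ∧ ∀ m b, D (c m b) = 0)
    (hDc : ∀ m b, ∃ D : Derivation ℂ E E, (fun b => D (c m b)) = Pi.single b 1 ∧
      (∀ m', m' ≠ m → (fun b => D (c m' b)) = 0) ∧ (∀ i l s, D (p i l s) = 0) ∧
      (∀ i l s, D (q i l s) = 0))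
    (w : Fin n → Fin 2 → E) (hw : ∀ j s, seg (Function.update w j (Pi.single s 1)) ∈
      Submodule.span E (Set.range (tanVecs p q c))) (i₀ : ι) :
    ∃ (i : ι) (α : E), seg w = α • seg (p i) := by
  classical
  set L := Submodule.span E (Set.range (tanVecs p q c)) with hL
  have hupd : ∀ j v, seg (Function.update w j v) ∈ L := by
    intro j v
    rw [show v = v 0 • Pi.single 0 1 + v 1 • Pi.single 1 1 by funext s; fin_cases s <;> simp,
      seg_update_add, seg_update_smul, seg_update_smul]
    exact add_mem (L.smul_mem _ (hw j 0)) (L.smul_mem _ (hw j 1))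
  obtain ⟨a, ha⟩ := (Submodule.mem_span_range_iff_exists_fun E).1
    (Function.update_eq_self (⟨0, hn⟩ : Fin n) w ▸ hupd ⟨0, hn⟩ (w ⟨0, hn⟩))
  have hsum : ∀ D : Derivation ℂ E E, ∑ g, a g • (fun b => D (tanVecs p q c g b)) ∈ L := by
    intro D
    have h1 : (fun b => D (seg w b)) ∈ L := by
      rw [derivation_seg]
      exact L.sum_mem fun j _ => hupd j _
    rw [← ha, derivation_sum_smul] at h1
    exact (L.add_mem_iff_right
      (L.sum_mem fun g _ => L.smul_mem _ (Submodule.subset_span ⟨g, rfl⟩))).1 h1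
  have hkill : ∀ {f : Cube n → E}, (∀ g, f ⬝ᵥ tanVecs p q c g = 0) → ∀ v ∈ L, f ⬝ᵥ v = 0 := by
    intro f hf v hv
    obtain ⟨b, rfl⟩ := (Submodule.mem_span_range_iff_exists_fun E).1 hv
    rw [dotProduct_sum]
    simp [hf]
  have hc : ∀ m, a (Sum.inr m) = 0 := by
    intro m
    obtain ⟨f, hf, hd⟩ := hf i₀
    have hf0 : f ≠ 0 := by
      rintro rfl
      refine hd ?_
      have : hess (0 : Cube n → E) (p i₀) (q i₀) = 0 := by ext j l; simp [hess]
      have : Nonempty (Fin n) := ⟨⟨0, hn⟩⟩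
      rw [‹hess _ _ _ = 0›, det_zero]
    obtain ⟨b, hb⟩ := Function.ne_iff.1 hf0
    obtain ⟨D, hDm, hDm', hDp, hDq⟩ := hDc m b
    have h1 := hkill hf _ (hsum D)
    rw [Fintype.sum_sum_type, Finset.sum_eq_zero, zero_add, Finset.sum_eq_single m] at h1
    · change f ⬝ᵥ (a (Sum.inr m) • fun b => D (c m b)) = 0 at h1
      rw [hDm, dotProduct_smul, dotProduct_single, mul_one, smul_eq_mul] at h1
      exact (mul_eq_zero.1 h1).resolve_right hb
    · intro m' _ h
      change a (Sum.inr m') • (fun b => D (c m' b)) = 0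
      rw [hDm' m' h, smul_zero]
    · simp
    · intro g _
      change a (Sum.inl g) • (fun b => D (tan (p g.1) (q g.1) g.2 b)) = 0
      rw [derivation_tan_eq_zero D (hDp g.1) (hDq g.1), smul_zero]
  have hs : ∀ i l, a (Sum.inl (i, some l)) = 0 := by
    intro i
    obtain ⟨f, hf, hd⟩ := hf i
    suffices h : (fun l => a (Sum.inl (i, some l))) = 0 from fun l => congrFun h l
    refine (det_ne_zero_iff _).1 hd _ (funext fun j => ?_)
    obtain ⟨D, hDj, hDl, hDi, hDq, -⟩ := hDp i j
    have h1 := hkill hf _ (hsum D)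
    simp only [Fintype.sum_sum_type, hc, zero_smul, Finset.sum_const_zero, add_zero,
      Fintype.sum_prod_type] at h1
    rw [Finset.sum_eq_single i, Fintype.sum_option, dotProduct_add] at h1
    · have hnone : f ⬝ᵥ (a (Sum.inl (i, none)) •
          fun b => D (tanVecs p q c (Sum.inl (i, none)) b)) = 0 := by
        change f ⬝ᵥ (a (Sum.inl (i, none)) • fun b => D (seg (p i) b)) = 0
        rw [derivation_seg_eq D hDj hDl, dotProduct_smul]
        have := hf (Sum.inl (i, some j))
        change f ⬝ᵥ seg _ = 0 at this
        rw [this, smul_zero]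
      rw [hnone, zero_add, dotProduct_sum] at h1
      rw [Pi.zero_apply, ← h1, mulVec, dotProduct]
      refine Finset.sum_congr rfl fun l _ => ?_
      rw [hess_comm, mul_comm, dotProduct_smul, smul_eq_mul]
      congr 1
      change _ = f ⬝ᵥ fun b => D (tan (p i) (q i) (some l) b)
      rw [derivation_tan_some D hDj hDl (hDq i), hess, of_apply]
      split_ifs <;> simp
    · intro i' _ h
      refine Finset.sum_eq_zero fun o _ => ?_
      change a (Sum.inl (i', o)) • (fun b => D (tan (p i') (q i') o b)) = 0
      rw [derivation_tan_eq_zero D (hDi i' h) (hDq i'), smul_zero]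
    · simp
  refine eq_smul_of_eq_sum hn hV (fun i j => ?_) w (fun i => a (Sum.inl (i, none))) ?_ i₀
  · obtain ⟨D, h1, h2, h3, -⟩ := hDp i j
    exact ⟨D, h1, h2, h3⟩
  · rw [← ha]
    simp only [Fintype.sum_sum_type, hc, zero_smul, Finset.sum_const_zero, add_zero,
      Fintype.sum_prod_type, Fintype.sum_option, hs]
    rfl

end Tangency

section Generic

theorem Generic.forall {σ ι : Type*} [Finite ι] {P : ι → (σ → ℂ) → Prop}
    (h : ∀ i, Generic (P i)) : Generic fun x => ∀ i, P i x := by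
  cases nonempty_fintype ι
  choose F hF h using h
  refine ⟨∏ i, F i, Finset.prod_ne_zero_iff.2 fun i _ => hF i, fun x hx i => h i x ?_⟩
  rw [map_prod] at hx
  exact Finset.prod_ne_zero_iff.1 hx i (Finset.mem_univ i)

variable {R S : Type*} [CommRing R] [CommRing S] {κ β : Type*} [Fintype κ]

/-- The equations expressing `v` as the combination of `V` with coefficients `a`. -/
def spanEqn (V : κ → β → R) (v : β → R) (a : κ → R) (b : β) : R := v b - ∑ g, a g * V g b

/-- An equation whose solvability in `z` expresses that `v` and `v'` are not proportional. -/
def wedgeEqn [Fintype β] (v v' : β → R) (z : β × β → R) : R :=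
  ∑ r, z r * (v r.1 * v' r.2 - v r.2 * v' r.1) - 1

theorem map_spanEqn (φ : R →+* S) (V : κ → β → R) (v : β → R) (a : κ → R) (b : β) :
    φ (spanEqn V v a b) =
      spanEqn (fun g b => φ (V g b)) (fun b => φ (v b)) (fun g => φ (a g)) b := by
  simp [spanEqn]

theorem map_wedgeEqn [Fintype β] (φ : R →+* S) (v v' : β → R) (z : β × β → R) :
    φ (wedgeEqn v v' z) =
      wedgeEqn (fun b => φ (v b)) (fun b => φ (v' b)) (fun r => φ (z r)) := by
  simp [wedgeEqn]

variable {E : Type*} [Field E]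

theorem mem_span_iff_spanEqn {V : κ → β → E} {v : β → E} :
    v ∈ Submodule.span E (Set.range V) ↔ ∃ a, ∀ b, spanEqn V v a b = 0 := by
  rw [Submodule.mem_span_range_iff_exists_fun]
  refine exists_congr fun a => ?_
  rw [funext_iff]
  refine forall_congr' fun b => ?_
  rw [spanEqn, sub_eq_zero, eq_comm, Finset.sum_apply]
  rfl

theorem wedgeEqn_smul [Fintype β] (c : E) (v : β → E) (z : β × β → E) :
    wedgeEqn (c • v) v z ≠ 0 := by
  have : ∀ r : β × β, z r * ((c • v) r.1 * v r.2 - (c • v) r.2 * v r.1) = 0 := by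
    intro r
    simp only [Pi.smul_apply, smul_eq_mul]
    ring
  rw [wedgeEqn, Finset.sum_congr rfl fun r _ => this r]
  simp

theorem exists_wedgeEqn_eq_zero [Fintype β] {v v' : β → E} (hv' : v' ≠ 0)
    (h : ¬∃ c : E, v = c • v') :
    ∃ z, wedgeEqn v v' z = 0 := by
  classical
  obtain ⟨b, hb⟩ := Function.ne_iff.1 hv'
  have : ∃ b', v b' * v' b - v b * v' b' ≠ 0 := by
    by_contra! H
    refine h ⟨v b / v' b, funext fun b' => ?_⟩
    have hb : v' b ≠ 0 := hb
    rw [Pi.smul_apply, smul_eq_mul, div_mul_eq_mul_div, eq_div_iff hb, sub_eq_zero.1 (H b')]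
  obtain ⟨b', hb'⟩ := this
  refine ⟨Pi.single (b', b) (v b' * v' b - v b * v' b')⁻¹, ?_⟩
  rw [wedgeEqn, Finset.sum_eq_single (b', b)]
  · simp [hb']
  · intro r _ hr
    simp [Pi.single_eq_of_ne hr]
  · simp

end Generic

section GenericTangency

variable {n : ℕ} {ι T : Type} {R : Type*} [CommRing R]

theorem map_tanVecs {S : Type*} [CommRing S] (φ : R →+* S) (p q : ι → Fin n → Fin 2 → R)
    (c : T → Cube n → R) (g : (ι × Option (Fin n)) ⊕ T) (b : Cube n) :
    φ (tanVecs p q c g b) = tanVecs (fun i l s => φ (p i l s)) (fun i l s => φ (q i l s))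
      (fun m b => φ (c m b)) g b := by
  rcases g with g | m
  · exact map_tan φ _ _ _ _
  · rfl

/-- Coordinates of a family of points and a family of vectors. -/
abbrev VIdx (ι T : Type) (n : ℕ) : Type := (ι × Fin n × Fin 2) ⊕ (T × Cube n)

/-- The factors of the points of a family. -/
def vpt (y : VIdx ι T n → R) : ι → Fin n → Fin 2 → R := fun i l s => y (Sum.inl (i, l, s))

/-- The vectors of a family. -/
def vvec (y : VIdx ι T n → R) : T → Cube n → R := fun m b => y (Sum.inr (m, b))

/-- Unknowns: the factors of a decomposable tensor, coefficients of the generators of its tangent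
space, and witnesses for its being different from given points. -/
abbrev UIdx (ι T : Type) (n : ℕ) : Type :=
  (Fin n × Fin 2) ⊕ ((Fin n × Fin 2) × ((ι × Option (Fin n)) ⊕ T)) ⊕ (ι × Cube n × Cube n)

variable [Fintype ι] [Fintype T]

/-- The left-hand side of the equations saying that the decomposable tensor described by `t` is
tangent to the span of `V` and different from the points `p`. -/
def tanEqn (V : (ι × Option (Fin n)) ⊕ T → Cube n → R) (p : ι → Fin n → Fin 2 → R)
    (t : UIdx ι T n → R) : (Fin n × Fin 2) × Cube n ⊕ ι → R :=
  Sum.elim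
    (fun r => spanEqn V (seg (Function.update (fun l s => t (Sum.inl (l, s))) r.1.1
      (Pi.single r.1.2 1))) (fun g => t (Sum.inr (Sum.inl (r.1, g)))) r.2)
    (fun i => wedgeEqn (seg fun l s => t (Sum.inl (l, s))) (seg (p i))
      (fun r => t (Sum.inr (Sum.inr (i, r)))))

theorem map_tanEqn {S : Type*} [CommRing S] (φ : R →+* S)
    (V : (ι × Option (Fin n)) ⊕ T → Cube n → R) (p : ι → Fin n → Fin 2 → R)
    (t : UIdx ι T n → R) (r : (Fin n × Fin 2) × Cube n ⊕ ι) :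
    φ (tanEqn V p t r) = tanEqn (fun g b => φ (V g b)) (fun i l s => φ (p i l s))
      (fun u => φ (t u)) r := by
  rcases r with r | i
  · simp only [tanEqn, Sum.elim_inl, map_spanEqn, map_seg]
    congr 1
    funext b
    congr 1
    funext l s
    by_cases h : l = r.1.1
    · subst h
      simp [Pi.single_apply, apply_ite φ]
    · simp [h]
  · simp only [tanEqn, Sum.elim_inr, map_wedgeEqn, map_seg]

theorem exists_tanEqn_ne_zero {E : Type*} [Field E]
    {V : (ι × Option (Fin n)) ⊕ T → Cube n → E} {p : ι → Fin n → Fin 2 → E}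
    (h : ∀ w : Fin n → Fin 2 → E, (∀ j s, seg (Function.update w j (Pi.single s 1)) ∈
      Submodule.span E (Set.range V)) → ∃ (i : ι) (α : E), seg w = α • seg (p i))
    (t : UIdx ι T n → E) : ∃ r, tanEqn V p t r ≠ 0 := by
  by_contra! H
  obtain ⟨i, α, hα⟩ := h (fun l s => t (Sum.inl (l, s))) fun j s =>
    mem_span_iff_spanEqn.2 ⟨fun g => t (Sum.inr (Sum.inl ((j, s), g))),
      fun b => H (Sum.inl ((j, s), b))⟩
  have := H (Sum.inr i)
  rw [tanEqn, Sum.elim_inr, hα] at this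
  exact wedgeEqn_smul _ _ _ this

theorem exists_tanEqn_eq_zero {E : Type*} [Field E]
    {V : (ι × Option (Fin n)) ⊕ T → Cube n → E} {p : ι → Fin n → Fin 2 → E}
    (hp : ∀ i, seg (p i) ≠ 0) (w : Fin n → Fin 2 → E)
    (hw : ∀ j s, seg (Function.update w j (Pi.single s 1)) ∈ Submodule.span E (Set.range V))
    (h : ¬∃ (i : ι) (α : E), seg w = α • seg (p i)) : ∃ t, ∀ r, tanEqn V p t r = 0 := by
  push Not at h
  choose a ha using fun r : Fin n × Fin 2 => mem_span_iff_spanEqn.1 (hw r.1 r.2)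
  choose z hz using fun i => exists_wedgeEqn_eq_zero (hp i) (not_exists.2 (h i))
  refine ⟨Sum.elim (fun r => w r.1 r.2) (Sum.elim (fun r => a r.1 r.2) fun r => z r.1 r.2), ?_⟩
  rintro (r | i)
  · exact ha r.1 r.2
  · exact hz i

/-- A decomposable tensor over an extension of the field of rational functions, tangent to the span
of the tangent spaces at generic points and generic vectors, is one of these points. -/
theorem eq_smul_of_tangent_le_of_injective (hn : 0 < n) (i₀ : ι) {E : Type*} [Field E]
    [Algebra ℂ E] (φ : MvPolynomial (VIdx ι T n) ℂ →ₐ[ℂ] E) (hφ : Function.Injective φ)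
    (hD : ∀ v : VIdx ι T n → E, ∃ D : Derivation ℂ E E, ∀ s, D (φ (.X s)) = v s)
    (q : ι → Fin n → Fin 2 → ℂ)
    {V : (ι × Option (Fin n)) ⊕ T → Cube n → MvPolynomial (VIdx ι T n) ℂ}
    (hV : V = tanVecs (vpt MvPolynomial.X) (fun i l s => MvPolynomial.C (q i l s))
      (vvec MvPolynomial.X))
    {W : Matrix ((ι × Option (Fin n)) ⊕ T) (Cube n) (MvPolynomial (VIdx ι T n) ℂ)}
    [DecidableEq ((ι × Option (Fin n)) ⊕ T)] (hW : (of V * Wᵀ).det ≠ 0)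
    (f : ι → Cube n → MvPolynomial (VIdx ι T n) ℂ) (hf : ∀ i g, f i ⬝ᵥ V g = 0)
    (hfd : ∀ i, (hess (f i) (vpt MvPolynomial.X i) fun l s => MvPolynomial.C (q i l s)).det ≠ 0)
    (w : Fin n → Fin 2 → E) (hw : ∀ j s, seg (Function.update w j (Pi.single s 1)) ∈
      Submodule.span E (Set.range fun g b => φ (V g b))) :
    ∃ (i : ι) (α : E), seg w = α • seg fun l s => φ (vpt MvPolynomial.X i l s) := by
  classical
  have hVE : (fun g b => φ (V g b)) = tanVecs (fun i l s => φ (vpt MvPolynomial.X i l s))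
      (fun i l s => φ (MvPolynomial.C (q i l s))) (fun m b => φ (vvec MvPolynomial.X m b)) := by
    funext g b
    rw [hV]
    exact map_tanVecs φ.toRingHom _ _ _ g b
  have hq : ∀ (D : Derivation ℂ E E) i l s, D (φ (MvPolynomial.C (q i l s))) = 0 := by
    intro D i l s
    rw [← MvPolynomial.algebraMap_eq, AlgHom.commutes, Derivation.map_algebraMap]
  rw [hVE] at hw
  refine eq_smul_of_tangent_le hn ?_ (fun i => ⟨fun b => φ (f i b), fun g => ?_, ?_⟩) ?_ ?_ w hw i₀
  · rw [← hVE]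
    exact linearIndependent_of_det φ.toRingHom (of V) W ((map_ne_zero_iff φ hφ).2 hW)
  · rw [← congrFun hVE g, ← map_zero φ, ← hf i g]
    exact (map_dotProduct' φ.toRingHom _ _).symm
  · have h1 := (map_ne_zero_iff φ hφ).2 (hfd i)
    have h2 := map_det_hess φ.toRingHom (f i) (vpt MvPolynomial.X i)
      fun l s => MvPolynomial.C (q i l s)
    exact fun h => h1 (h2.trans h)
  · intro i j
    obtain ⟨D, hD⟩ := hD (Sum.elim
      (fun r => if r.1 = i ∧ r.2.1 = j then φ (MvPolynomial.C (q i j r.2.2)) else 0) 0)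
    refine ⟨D, fun s => ?_, fun l hl s => ?_, fun i' hi l s => ?_, hq D, fun m b => ?_⟩
    · simp [vpt, hD]
    · simp [vpt, hD, hl]
    · simp [vpt, hD, hi]
    · simp [vvec, hD]
  · intro m b
    obtain ⟨D, hD⟩ := hD (Sum.elim 0 (fun r => if r.1 = m ∧ r.2 = b then 1 else 0))
    refine ⟨D, funext fun b' => ?_, fun m' hm => funext fun b' => ?_, fun i l s => ?_, hq D⟩
    · simp [vvec, hD, Pi.single_apply]
    · simp [vvec, hD, hm]
    · simp [vpt, hD]

theorem exists_generic_tangent (hn : 0 < n) (i₀ : ι) (hC : ∀ i : ι, Config ℂ n ι i)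
    (hcard : Fintype.card ι * (n + 1) + Fintype.card T < 2 ^ n) :
    ∃ q : ι → Fin n → Fin 2 → ℂ, Generic fun y : VIdx ι T n → ℂ =>
      LinearIndependent ℂ (tanVecs (vpt y) q (vvec y)) ∧
      ∀ w : Fin n → Fin 2 → ℂ, (∀ j s, seg (Function.update w j (Pi.single s 1)) ∈
        Submodule.span ℂ (Set.range (tanVecs (vpt y) q (vvec y)))) →
        ∃ (i : ι) (α : ℂ), seg w = α • seg (vpt y i) := by
  classical
  obtain ⟨y, hy⟩ := (Generic.forall fun i => (hC i).generic (T := T) hcard).exists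
  let q : ι → Fin n → Fin 2 → ℂ := fun i => dir y (Sum.inl i)
  let x : VIdx ι T n → ℂ := Sum.elim (fun r => pt y (Sum.inl r.1) r.2.1 r.2.2)
    fun r => seg (pt y (Sum.inr r.1)) r.2
  let V := tanVecs (vpt (MvPolynomial.X (R := ℂ)))
    (fun i l s => MvPolynomial.C (σ := VIdx ι T n) (q i l s)) (vvec MvPolynomial.X)
  have hVe : ∀ z : VIdx ι T n → ℂ, (fun g b => MvPolynomial.eval z (V g b)) =
      tanVecs (vpt z) q (vvec z) := by
    intro z
    funext g b
    simp only [V, map_tanVecs, vpt, vvec, MvPolynomial.eval_X, MvPolynomial.eval_C]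
    rfl
  have hVx : tanVecs (vpt x) q (vvec x) = gensPts y := rfl
  have hLx : LinearIndependent ℂ (fun g b => MvPolynomial.eval x (V g b)) := by
    rw [hVe, hVx]
    exact (hy i₀).1
  have hgen := generic_linearIndependent V x hLx
  obtain ⟨W, hW⟩ := exists_det_eq_one (MvPolynomial.eval x) (eval_surjective x) (of V) hLx
  have hW0 : (of V * Wᵀ).det ≠ 0 := by
    intro h
    rw [h, map_zero] at hW
    exact zero_ne_one hW
  have hf : ∀ i, ∃ f : Cube n → MvPolynomial (VIdx ι T n) ℂ, (∀ g, f ⬝ᵥ V g = 0) ∧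
      (hess f (vpt MvPolynomial.X i) (fun l s => MvPolynomial.C (q i l s))).det ≠ 0 := by
    intro i
    obtain ⟨-, f₀, hf₀, hd⟩ := hy i
    obtain ⟨f, hf, hfe⟩ := exists_polynomial_annihilator V x hLx f₀
      (fun g => by rw [congrFun (hVe x) g, hVx]; exact hf₀ g)
    refine ⟨f, hf, fun h => hd ?_⟩
    have h1 := congrArg (MvPolynomial.eval x) h
    rw [map_det_hess, map_zero] at h1
    simp only [hfe, vpt, MvPolynomial.eval_X, MvPolynomial.eval_C] at h1
    exact h1
  choose f hfV hfd using hf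
  let P := tanEqn (fun g b => MvPolynomial.C (σ := UIdx ι T n) (V g b))
    (fun i l s => MvPolynomial.C (vpt MvPolynomial.X i l s)) MvPolynomial.X
  have hP : ∀ {E : Type} [Field E] (φ : MvPolynomial (VIdx ι T n) ℂ →+* E) (t : UIdx ι T n → E)
      r, MvPolynomial.eval₂ φ t (P r) = tanEqn (fun g b => φ (V g b))
        (fun i l s => φ (vpt MvPolynomial.X i l s)) t r := by
    intro E _ φ t r
    rw [← MvPolynomial.coe_eval₂Hom, map_tanEqn]
    simp
  have hsol := generic_no_solution (Set.range P) (by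
    intro E _ _ φ hφ hD t
    suffices h : ∃ r, tanEqn (fun g b => φ (V g b))
        (fun i l s => φ (vpt MvPolynomial.X i l s)) t r ≠ 0 by
      obtain ⟨r, hr⟩ := h
      exact ⟨_, ⟨r, rfl⟩, by rwa [hP]⟩
    exact exists_tanEqn_ne_zero
      (eq_smul_of_tangent_le_of_injective hn i₀ φ hφ hD q rfl hW0 f hfV hfd) t)
  refine ⟨q, ?_⟩
  obtain ⟨G, hG, h⟩ := hgen.and hsol
  refine ⟨G, hG, fun z hz => ?_⟩
  obtain ⟨hli, hno⟩ := h z hz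
  rw [hVe] at hli
  refine ⟨hli, fun w hw => ?_⟩
  by_contra hne
  obtain ⟨t, ht⟩ := exists_tanEqn_eq_zero (p := vpt z)
    (fun i => hli.ne_zero (Sum.inl (i, none))) w hw hne
  obtain ⟨_, ⟨r, rfl⟩, hr⟩ := hno t
  refine hr ?_
  rw [hP, hVe]
  simp only [vpt, MvPolynomial.eval_X]
  exact ht r

end GenericTangency

section Bridge

variable {n : ℕ}

/-- Coordinates on the space of tensors. -/
def coords (n : ℕ) : Ten n (fun _ => 1) ≃ₗ[ℂ] (Cube n → ℂ) :=
  (Basis.piTensorProduct fun _ : Fin n => Pi.basisFun ℂ (Fin 2)).equivFun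

theorem coords_tprod (v : Fin n → Fin 2 → ℂ) : coords n (tprod ℂ v) = seg v := by
  funext b
  rw [coords, Module.Basis.equivFun_apply, Basis.piTensorProduct_repr_tprod_apply]
  rfl

theorem coords_fromCoords (c : Cube n → ℂ) : coords n (fromCoords (fun _ => 1) c) = c := by
  classical
  unfold fromCoords basisVec
  rw [map_sum]
  funext b
  rw [Finset.sum_apply, Finset.sum_eq_single b]
  · rw [map_smul, coords_tprod]
    simp [seg]
  · intro b' _ hb
    obtain ⟨l, hl⟩ := Function.ne_iff.1 hb
    rw [map_smul, coords_tprod, Pi.smul_apply, seg, Finset.prod_eq_zero (Finset.mem_univ l),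
      smul_zero]
    exact Pi.single_eq_of_ne (Ne.symm hl) _
  · simp

theorem map_tangent (p : Fin n → Fin 2 → ℂ) :
    (tangent (fun _ => 1) p).map (coords n : Ten n (fun _ => 1) →ₗ[ℂ] Cube n → ℂ) =
      Submodule.span ℂ {x | ∃ j u, x = seg (Function.update p j u)} := by
  rw [tangent, Submodule.map_span]
  congr 1
  ext x
  constructor
  · rintro ⟨_, ⟨j, u, rfl⟩, rfl⟩
    exact ⟨j, u, coords_tprod _⟩
  · rintro ⟨j, u, rfl⟩
    exact ⟨_, ⟨j, u, rfl⟩, coords_tprod _⟩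

theorem exists_eq_add_smul {v w : Fin 2 → ℂ} (h : LinearIndependent ℂ ![v, w]) (u : Fin 2 → ℂ) :
    ∃ α β : ℂ, u = α • v + β • w := by
  have hs := h.span_eq_top_of_card_eq_finrank (by simp)
  have hu : u ∈ Submodule.span ℂ (Set.range ![v, w]) := hs ▸ Submodule.mem_top
  rw [Matrix.range_cons, Matrix.range_cons, Matrix.range_empty, Set.union_empty,
    Set.singleton_union, Submodule.mem_span_pair] at hu
  obtain ⟨α, β, h⟩ := hu
  exact ⟨α, β, h.symm⟩

theorem linearIndependent_factor {p q : Fin n → Fin 2 → ℂ} (h : LinearIndependent ℂ (tan p q))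
    (j : Fin n) : LinearIndependent ℂ ![p j, q j] := by
  rw [LinearIndependent.pair_iff]
  intro α β hαβ
  have h0 : α • tan p q none + β • tan p q (some j) = 0 := by
    change α • seg p + β • seg (Function.update p j (q j)) = 0
    conv_lhs => enter [1, 2]; rw [← Function.update_eq_self j p]
    rw [← seg_update_smul, ← seg_update_smul, ← seg_update_add, hαβ, seg_update_zero]
  exact (LinearIndepOn.pair_iff (tan p q) (Option.some_ne_none j).symm).1
    (h.comp _ Subtype.val_injective) α β h0

theorem span_update_eq_span_tan (hn : 0 < n) {p q : Fin n → Fin 2 → ℂ}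
    (h : LinearIndependent ℂ (tan p q)) :
    Submodule.span ℂ {x | ∃ j u, x = seg (Function.update p j u)} =
      Submodule.span ℂ (Set.range (tan p q)) := by
  apply le_antisymm
  · rw [Submodule.span_le]
    rintro _ ⟨j, u, rfl⟩
    obtain ⟨α, β, rfl⟩ := exists_eq_add_smul (linearIndependent_factor h j) u
    rw [seg_update_add, seg_update_smul, seg_update_smul, Function.update_eq_self]
    exact add_mem (Submodule.smul_mem _ _ (Submodule.subset_span ⟨none, rfl⟩))
      (Submodule.smul_mem _ _ (Submodule.subset_span ⟨some j, rfl⟩))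
  · rw [Submodule.span_le]
    rintro _ ⟨_ | j, rfl⟩
    · exact Submodule.subset_span ⟨⟨0, hn⟩, p ⟨0, hn⟩, by rw [Function.update_eq_self]; rfl⟩
    · exact Submodule.subset_span ⟨j, q j, rfl⟩

theorem map_tangent_sup {k e : ℕ} (hn : 0 < n) {p q : Fin k → Fin n → Fin 2 → ℂ}
    {c : Fin e → Cube n → ℂ} (h : LinearIndependent ℂ (tanVecs p q c)) :
    ((⨆ i, tangent (fun _ => 1) (p i)) ⊔
      Submodule.span ℂ (Set.range fun m => fromCoords (fun _ => 1) (c m))).map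
        (coords n : Ten n (fun _ => 1) →ₗ[ℂ] Cube n → ℂ) =
      Submodule.span ℂ (Set.range (tanVecs p q c)) := by
  have h1 : ∀ i, LinearIndependent ℂ (tan (p i) (q i)) := fun i =>
    h.comp (fun o => Sum.inl (i, o)) fun a b hab => by simpa using hab
  have h2 : Set.range (tanVecs p q c) =
      (⋃ i, Set.range (tan (p i) (q i))) ∪ Set.range c := by
    rw [tanVecs, Set.Sum.elim_range]
    congr 1
    ext x
    simp
  rw [Submodule.map_sup, Submodule.map_iSup, h2, Submodule.span_union, Submodule.span_iUnion]
  congr 1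
  · exact iSup_congr fun i => (map_tangent _).trans (span_update_eq_span_tan hn (h1 i))
  · rw [Submodule.map_span, ← Set.range_comp]
    congr 2
    funext m
    exact coords_fromCoords _

theorem tangentGeneral_of_config {k d : ℕ} (hn : 0 < n) (hk : 0 < k)
    (hC : ∀ i : Fin k, Config ℂ n (Fin k) i) (hkd : k * (n + 1) ≤ d) (hd : d < 2 ^ n) :
    TangentGeneral n (fun _ => 1) k d := by
  have he : k * (1 + ∑ _ : Fin n, 1) = k * (n + 1) := by simp [add_comm]
  unfold TangentGeneral
  rw [he]
  obtain ⟨q, hq⟩ := exists_generic_tangent (T := Fin (d - k * (n + 1))) hn ⟨0, hk⟩ hC (by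
    rw [Fintype.card_fin, Fintype.card_fin]
    omega)
  obtain ⟨F, hF, h⟩ := hq.comp (τ := WIdx n (fun _ => 1) k ⊕
      (Fin (d - k * (n + 1)) × BIdx n (fun _ => 1)))
    (Sum.map (fun r => (r.1, ⟨r.2.1, r.2.2⟩)) id) (by
      refine Function.Injective.sumMap ?_ Function.injective_id
      rintro ⟨i, l, s⟩ ⟨i', l', s'⟩ h
      simp only [Prod.mk.injEq, Sigma.mk.injEq] at h
      obtain ⟨rfl, rfl, h⟩ := h
      rw [eq_of_heq h])
  refine ⟨F, ?_, fun p c hpc => ?_⟩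
  · obtain ⟨x, hx⟩ := exists_eval_ne_zero hF
    refine ⟨fun i l s => x (Sum.inl (i, ⟨l, s⟩)), fun m b => x (Sum.inr (m, b)), ?_⟩
    convert hx using 2
    unfold evalWV
    congr 2
    funext r
    rcases r with r | r <;> rfl
  · obtain ⟨hli, hw⟩ := h _ hpc
    change LinearIndependent ℂ (tanVecs p q c) at hli
    have hmap := map_tangent_sup hn hli
    constructor
    · rw [← (coords n).finrank_map_eq, hmap, finrank_span_eq_card hli]
      simp only [Fintype.card_sum, Fintype.card_prod, Fintype.card_option, Fintype.card_fin]
      omega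
    · intro w _ hwL
      have h1 := Submodule.map_mono (f := (coords n : Ten n (fun _ => 1) →ₗ[ℂ] Cube n → ℂ)) hwL
      rw [hmap, map_tangent] at h1
      obtain ⟨i, α, hα⟩ := hw w fun j s => h1 (Submodule.subset_span ⟨j, _, rfl⟩)
      refine ⟨i, α, (coords n).injective ?_⟩
      rw [map_smul, coords_tprod]
      refine hα.trans ?_
      rw [coords_tprod]
      rfl

end Bridge

section Transfer

/-- A configuration over any field lifts to the complex numbers. -/
theorem Config.complex {F : Type*} [Field F] {n : ℕ} {ι : Type} [Fintype ι] {i : ι}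
    (h : Config F n ι i) : Config ℂ n ι i := by
  classical
  obtain ⟨x, f₀, hx, hf₀, hd⟩ := h
  let φ : MvPolynomial F ℤ →+* F := MvPolynomial.eval₂Hom (Int.castRingHom F) id
  have hφX : ∀ a, φ (MvPolynomial.X a) = a := fun a => MvPolynomial.eval₂Hom_X' _ _ _
  have hφ : Function.Surjective φ := fun a => ⟨_, hφX a⟩
  let X : PIdx ι n → MvPolynomial F ℤ := fun r => MvPolynomial.X (x r)
  have hφg : (fun g b => φ (gens X g b)) = gens x := by
    funext g b
    rw [map_gens]
    simp only [X, hφX]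
  obtain ⟨W, hW⟩ := exists_det_eq_one φ hφ (of (gens X)) (by
    change LinearIndependent F (fun g b => φ (gens X g b))
    rwa [hφg])
  obtain ⟨f, hf, hfe⟩ := exists_lift_annihilator φ hφ (of (gens X)) W hW f₀ (by
    change ∀ g, f₀ ⬝ᵥ (fun b => φ (gens X g b)) = 0
    intro g
    rw [congrFun hφg g]
    exact hf₀ g)
  have hD : (of (gens X) * Wᵀ).det * (hess f (pt X i) (dir X i)).det ≠ 0 := by
    intro h0
    have h1 := congrArg φ h0
    rw [map_mul, hW, one_mul, map_det_hess, map_zero] at h1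
    refine hd ?_
    simp only [hfe, pt, dir, X, hφX] at h1
    exact h1
  obtain ⟨y, hy⟩ := exists_eval_ne_zero (F := MvPolynomial.map (Int.castRingHom ℂ) _)
    ((map_ne_zero_iff _ (MvPolynomial.map_injective _ Int.cast_injective)).2 hD)
  let ψ : MvPolynomial F ℤ →+* ℂ :=
    (MvPolynomial.eval y).comp (MvPolynomial.map (Int.castRingHom ℂ))
  change ψ _ ≠ 0 at hy
  rw [map_mul] at hy
  refine ⟨fun r => ψ (X r), fun b => ψ (f b), ?_, fun g => ?_, ?_⟩
  · have := linearIndependent_of_det ψ (of (gens X)) W (left_ne_zero_of_mul hy)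
    simp only [of_apply, map_gens] at this
    exact this
  · have := congrArg ψ (hf g)
    rw [map_dotProduct', map_zero] at this
    simp only [of_apply, map_gens] at this
    exact this
  · have := right_ne_zero_of_mul hy
    rwa [map_det_hess] at this

end Transfer

section Gauss

/-- The number with digits `d` in base `β`. -/
def pack (β : ℕ) {m : ℕ} (d : Fin m → ℕ) : ℕ := ∑ k, d k * β ^ (k : ℕ)

theorem pack_succ (β : ℕ) {m : ℕ} (d : Fin (m + 1) → ℕ) :
    pack β d = d 0 + β * pack β (Fin.tail d) := by
  simp only [pack, Fin.sum_univ_succ, Fin.val_zero, pow_zero, mul_one, Fin.val_succ, Finset.mul_sum,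
    Fin.tail]
  refine congrArg (_ + ·) (Finset.sum_congr rfl fun k _ => ?_)
  ring

theorem pack_add_smul (β c : ℕ) {m : ℕ} (d d' : Fin m → ℕ) :
    pack β (d + c • d') = pack β d + c * pack β d' := by
  simp only [pack, Pi.add_apply, Pi.smul_apply, smul_eq_mul, Finset.mul_sum,
    ← Finset.sum_add_distrib]
  exact Finset.sum_congr rfl fun k _ => by ring

theorem pack_mod {β m : ℕ} {d : Fin (m + 1) → ℕ} (h : d 0 < β) : pack β d % β = d 0 := by
  rw [pack_succ, Nat.add_mul_mod_self_left, Nat.mod_eq_of_lt h]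

theorem pack_div {β m : ℕ} {d : Fin (m + 1) → ℕ} (h : d 0 < β) :
    pack β d / β = pack β (Fin.tail d) := by
  rw [pack_succ, Nat.add_mul_div_left _ _ (by omega), Nat.div_eq_of_lt h, zero_add]

/-- The first row whose leading digit is a unit modulo `p`, and the other rows. -/
def pivot (β p : ℕ) : List ℕ → Option (ℕ × List ℕ)
  | [] => none
  | R :: L => bif Nat.beq (Nat.mod (Nat.mod R β) p) 0 then
      (match pivot β p L with
        | none => none
        | some (P, L') => some (P, R :: L'))
      else some (R, L)

/-- Subtract a multiple of the pivot row `P` from every row and drop the leading digit. The number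
`c` is minus the inverse of the leading digit of `P`. -/
def eliminate (β p P c : ℕ) (L : List ℕ) : List ℕ :=
  List.rec [] (fun R _ ih =>
    Nat.div (Nat.add R (Nat.mul (Nat.mod (Nat.mul (Nat.mod R β) c) p) P)) β :: ih) L

/-- Gaussian elimination modulo `p` on rows of `m` digits in base `β`. -/
def hasFullRank (β p : ℕ) : ℕ → List ℕ → Bool
  | 0, _ => true
  | m + 1, L =>
    match pivot β p L with
    | none => false
    | some (P, L') => hasFullRank β p m (eliminate β p P (p - (P % β) ^ (p - 2) % p) L')

theorem eliminate_eq_map (β p P c : ℕ) (L : List ℕ) :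
    eliminate β p P c L = L.map fun R => (R + R % β * c % p * P) / β := by
  induction L with
  | nil => rfl
  | cons R L ih => exact congrArg (_ :: ·) ih

theorem of_pivot_eq_some {β p P : ℕ} {L L' : List ℕ} (h : pivot β p L = some (P, L')) :
    P % β % p ≠ 0 ∧ P ∈ L ∧ ∀ R ∈ L', R ∈ L := by
  induction L generalizing L' with
  | nil => simp [pivot] at h
  | cons R L ih =>
    rw [pivot] at h
    cases hR : Nat.beq (Nat.mod (Nat.mod R β) p) 0 with
    | false =>
      rw [hR, cond_false, Option.some.injEq, Prod.mk.injEq] at h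
      obtain ⟨rfl, rfl⟩ := h
      exact ⟨Nat.ne_of_beq_eq_false hR, by simp, fun R' hR' => List.mem_cons_of_mem _ hR'⟩
    | true =>
      rw [hR, cond_true] at h
      cases hL : pivot β p L with
      | none => simp [hL] at h
      | some r =>
        obtain ⟨P', L''⟩ := r
        simp only [hL, Option.some.injEq, Prod.mk.injEq] at h
        obtain ⟨rfl, rfl⟩ := h
        obtain ⟨h1, h2, h3⟩ := ih hL
        refine ⟨h1, List.mem_cons_of_mem _ h2, fun R' hR' => ?_⟩
        rcases List.mem_cons.1 hR' with rfl | hR'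
        · exact List.mem_cons_self
        · exact List.mem_cons_of_mem _ (h3 R' hR')

variable {F : Type*} [Field F]

/-- `R` encodes a row with digits at most `M` that annihilates `x`. -/
def Annihilates (β M : ℕ) {m : ℕ} (x : Fin m → F) (R : ℕ) : Prop :=
  ∃ d : Fin m → ℕ, (∀ k, d k ≤ M) ∧ R = pack β d ∧ ∑ k, (d k : F) * x k = 0

variable (p : ℕ) [Fact p.Prime] [CharP F p]

theorem natCast_neg_inv {e : ℕ} (he : e % p ≠ 0) :
    ((p - e ^ (p - 2) % p : ℕ) : F) * e = -1 := by
  have hp : p.Prime := Fact.out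
  have h2 := hp.two_le
  have he' : (e : F) ≠ 0 := by
    rw [Ne, CharP.cast_eq_zero_iff F p]
    exact fun h => he (Nat.mod_eq_zero_of_dvd h)
  have h1 : (e : F) ^ p = e := by
    rw [← frobenius_def]
    exact map_natCast (frobenius F p) e
  rw [Nat.cast_sub (Nat.mod_lt _ hp.pos).le, CharP.cast_eq_zero, ← CharP.cast_eq_mod,
    Nat.cast_pow, zero_sub, neg_mul, ← pow_succ]
  refine congrArg Neg.neg (mul_right_cancel₀ he' ?_)
  rw [← pow_succ, one_mul, show p - 2 + 1 + 1 = p by omega, h1]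

theorem Annihilates.eliminate {β M m : ℕ} {x : Fin (m + 1) → F} {P R : ℕ}
    (hM : p * M < β) (hP : Annihilates β M x P) (hR : Annihilates β M x R)
    (h0 : P % β % p ≠ 0) : Annihilates β (p * M) (Fin.tail x)
      ((R + R % β * (p - (P % β) ^ (p - 2) % p) % p * P) / β) := by
  have hp : p.Prime := Fact.out
  obtain ⟨e, he, rfl, hex⟩ := hP
  obtain ⟨d, hd, rfl, hdx⟩ := hR
  have hMβ : M < β := (Nat.le_mul_of_pos_left M hp.pos).trans_lt hM
  rw [pack_mod ((he 0).trans_lt hMβ)] at h0 ⊢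
  rw [pack_mod ((hd 0).trans_lt hMβ)]
  have hinv := natCast_neg_inv (F := F) p h0
  set c := p - e 0 ^ (p - 2) % p
  set t := d 0 * c % p with ht
  have htp : t < p := Nat.mod_lt _ hp.pos
  have hle : ∀ k, (d + t • e) k ≤ p * M := by
    intro k
    simp only [Pi.add_apply, Pi.smul_apply, smul_eq_mul]
    calc d k + t * e k ≤ M + t * M := Nat.add_le_add (hd k) (Nat.mul_le_mul_left t (he k))
      _ = (t + 1) * M := by ring
      _ ≤ p * M := Nat.mul_le_mul_right M htp
  refine ⟨Fin.tail (d + t • e), fun k => hle k.succ, ?_, ?_⟩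
  · rw [← pack_add_smul, pack_div ((hle 0).trans_lt hM)]
  · have htF : (t : F) = d 0 * c := by
      rw [ht, ← CharP.cast_eq_mod, Nat.cast_mul]
    have hsum : ∑ k, ((d + t • e) k : F) * x k = 0 := by
      simp only [Pi.add_apply, Pi.smul_apply, smul_eq_mul, Nat.cast_add, Nat.cast_mul, add_mul,
        Finset.sum_add_distrib, mul_assoc, ← Finset.mul_sum, hex, hdx, mul_zero, add_zero]
    rw [Fin.sum_univ_succ] at hsum
    have hzero : ((d + t • e) 0 : F) = 0 := by
      simp only [Pi.add_apply, Pi.smul_apply, smul_eq_mul, Nat.cast_add, Nat.cast_mul, htF,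
        mul_assoc, hinv]
      ring
    rwa [hzero, zero_mul, zero_add] at hsum

theorem eq_zero_of_hasFullRank {β m M : ℕ} (x : Fin m → F) {L : List ℕ} (hM : p ^ m * M < β)
    (hL : ∀ R ∈ L, Annihilates β M x R) (h : hasFullRank β p m L = true) : x = 0 := by
  have hp : p.Prime := Fact.out
  induction m generalizing L M with
  | zero => exact funext fun k => k.elim0
  | succ m ih =>
    rw [hasFullRank] at h
    cases hpiv : pivot β p L with
    | none => simp [hpiv] at h
    | some r =>
      obtain ⟨P, L'⟩ := r
      simp only [hpiv] at h
      obtain ⟨h0, hPL, hL'⟩ := of_pivot_eq_some hpiv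
      have hpM : p * M < β := by
        refine lt_of_le_of_lt (Nat.mul_le_mul_right M ?_) hM
        exact Nat.le_self_pow (by omega) p
      have htail : Fin.tail x = 0 := by
        refine ih (M := p * M) (Fin.tail x) (by rwa [← mul_assoc, ← pow_succ]) ?_ h
        intro R hR
        rw [eliminate_eq_map, List.mem_map] at hR
        obtain ⟨R, hR, rfl⟩ := hR
        exact Annihilates.eliminate p hpM (hL P hPL) (hL R (hL' R hR)) h0
      obtain ⟨e, he, rfl, hex⟩ := hL P hPL
      have hMβ : M < β := (Nat.le_mul_of_pos_left M hp.pos).trans_lt hpM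
      rw [pack_mod ((he 0).trans_lt hMβ)] at h0
      have hsucc : ∀ k : Fin m, x k.succ = 0 := fun k => congrFun htail k
      simp only [Fin.sum_univ_succ, hsucc, mul_zero, Finset.sum_const_zero, add_zero] at hex
      have hx0 : x 0 = 0 := (mul_eq_zero.1 hex).resolve_left fun hz =>
        h0 (Nat.mod_eq_zero_of_dvd ((CharP.cast_eq_zero_iff F p _).1 hz))
      exact funext (Fin.cases hx0 hsucc)

end Gauss

section Rows

theorem pack_digit {β m : ℕ} {d : Fin m → ℕ} (h : ∀ k, d k < β) (k : Fin m) :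
    pack β d / β ^ (k : ℕ) % β = d k := by
  induction m with
  | zero => exact k.elim0
  | succ m ih =>
    refine Fin.cases ?_ (fun k => ?_) k
    · rw [Fin.val_zero, pow_zero, Nat.div_one, pack_mod (h 0)]
    · rw [Fin.val_succ, pow_succ', ← Nat.div_div_eq_div_mul, pack_div (h 0),
        ih (d := Fin.tail d) (fun k => h k.succ)]
      rfl

theorem pack_digits {β m N : ℕ} (h : N < β ^ m) :
    pack β (fun k : Fin m => N / β ^ (k : ℕ) % β) = N := by
  induction m generalizing N with
  | zero => simp only [pow_zero, Nat.lt_one_iff] at h; simp [pack, h]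
  | succ m ih =>
    have hN : N / β < β ^ m := by
      rw [pow_succ'] at h
      exact Nat.div_lt_of_lt_mul h
    have htail : Fin.tail (fun k : Fin (m + 1) => N / β ^ (k : ℕ) % β) =
        fun k : Fin m => N / β / β ^ (k : ℕ) % β := by
      funext k
      rw [Fin.tail, Fin.val_succ, pow_succ', Nat.div_div_eq_div_mul]
    rw [pack_succ, htail, ih hN, Fin.val_zero, pow_zero, Nat.div_one, Nat.mod_add_div]

theorem pack_sum {β m : ℕ} {ι : Type*} (T : Finset ι) (c : ι → ℕ) (d : ι → Fin m → ℕ) :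
    pack β (fun k => ∑ t ∈ T, c t * d t k) = ∑ t ∈ T, c t * pack β (d t) := by
  simp only [pack, Finset.sum_mul, Finset.mul_sum, mul_assoc]
  exact Finset.sum_comm

theorem pack_prod (β : ℕ) {s m : ℕ} (w : Fin s → ℕ) (u : Fin m → ℕ) :
    pack β (fun k : Fin (s * m) => w k.divNat * u k.modNat) =
      pack β u * pack (β ^ m) w := by
  unfold pack
  rw [← finProdFinEquiv.sum_comp, Fintype.sum_prod_type, Finset.sum_mul_sum, Finset.sum_comm]
  refine Finset.sum_congr rfl fun o _ => Finset.sum_congr rfl fun a _ => ?_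
  have h : finProdFinEquiv.symm (finProdFinEquiv (a, o)) = (a, o) := Equiv.symm_apply_apply _ _
  rw [finProdFinEquiv_symm_apply, Prod.mk.injEq] at h
  beta_reduce
  rw [h.1, h.2, finProdFinEquiv_apply_val, pow_add, pow_mul]
  ring

/-- The `j`-th binary digit of `N`. -/
def bit (N j : ℕ) : ℕ := N / 2 ^ j % 2

theorem bit_le_one (N j : ℕ) : bit N j ≤ 1 := Nat.le_of_lt_succ (Nat.mod_lt _ two_pos)

/-- The sum of the entries of `L` at the positions of the binary digits `1` of `N`. -/
def lin (L : List ℕ) : ℕ → ℕ :=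
  List.rec (fun _ => 0)
    (fun E _ ih N => Nat.add (Nat.mul (Nat.mod N 2) E) (ih (Nat.div N 2))) L

theorem lin_cons (E : ℕ) (L : List ℕ) (N : ℕ) : lin (E :: L) N = N % 2 * E + lin L (N / 2) := rfl

theorem lin_eq {n : ℕ} {L : List ℕ} (h : L.length = n) (N : ℕ) :
    lin L N = ∑ j : Fin n, bit N j * L.getD j 0 := by
  induction L generalizing N n with
  | nil => subst h; rfl
  | cons E L ih =>
    subst h
    rw [lin_cons, ih rfl]
    simp only [List.length_cons, Fin.sum_univ_succ, bit, Fin.val_zero, pow_zero, Nat.div_one,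
      List.getD_cons_zero, Fin.val_succ, List.getD_cons_succ, pow_succ', Nat.div_div_eq_div_mul]

/-- The number whose digits in base `B` are the residues modulo `p` of `2 ^ e`, for the first `s`
digits `e` of `S` in base `1000`. -/
def blocks (B p s : ℕ) : ℕ → ℕ :=
  Nat.rec (fun _ => 0)
    (fun _ ih S => Nat.add (Nat.mod (Nat.pow 2 (Nat.mod S 1000)) p)
      (Nat.mul B (ih (Nat.div S 1000)))) s

theorem blocks_eq (B p s S : ℕ) :
    blocks B p s S = pack B fun a : Fin s => 2 ^ (S / 1000 ^ (a : ℕ) % 1000) % p := by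
  induction s generalizing S with
  | zero => rfl
  | succ s ih =>
    have : blocks B p (s + 1) S = 2 ^ (S % 1000) % p + B * blocks B p s (S / 1000) := rfl
    rw [this, ih, pack_succ]
    simp only [Fin.val_zero, pow_zero, Nat.div_one, Fin.tail_def, Fin.val_succ,
      Nat.div_div_eq_div_mul, pow_succ']

/-- The first `n` terms of the geometric progression `x, x * β, …`. -/
def geom (β : ℕ) : ℕ → ℕ → List ℕ
  | 0, _ => []
  | n + 1, x => x :: geom β n (x * β)

theorem length_geom (β n x : ℕ) : (geom β n x).length = n := by
  induction n generalizing x with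
  | zero => rfl
  | succ n ih => rw [geom, List.length_cons, ih]

theorem getD_geom {β n j : ℕ} (x : ℕ) (h : j < n) : (geom β n x).getD j 0 = x * β ^ j := by
  induction n generalizing x j with
  | zero => omega
  | succ n ih =>
    cases j with
    | zero => simp [geom]
    | succ j => rw [geom, List.getD_cons_succ, ih _ (by omega), pow_succ', mul_assoc]

/-- The packed row of coordinates at the vertex `N` of the tangent vectors at `s` points. -/
def row (B s p : ℕ) (E U : List ℕ) (N : ℕ) : ℕ :=
  Nat.mul (Nat.succ (lin U N)) (blocks B p s (lin E N))

/-- The coefficients of the coordinate at the vertex `N` of a tangent vector. -/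
def coeffs (n N : ℕ) : Fin (n + 1) → ℕ := Fin.cons 1 fun j : Fin n => bit N j

theorem coeffs_le_one (n N : ℕ) (o : Fin (n + 1)) : coeffs n N o ≤ 1 := by
  refine Fin.cases le_rfl (fun j => ?_) o
  rw [coeffs, Fin.cons_succ]
  exact bit_le_one N j

/-- The digits of a row. -/
def rowDigits (n s p : ℕ) (E : List ℕ) (N : ℕ) (k : Fin (s * (n + 1))) : ℕ :=
  2 ^ (lin E N / 1000 ^ (k.divNat : ℕ) % 1000) % p * coeffs n N k.modNat

theorem rowDigits_le {n s p : ℕ} (hp : 0 < p) (E : List ℕ) (N : ℕ) (k : Fin (s * (n + 1))) :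
    rowDigits n s p E N k ≤ p :=
  (Nat.mul_le_mul (Nat.mod_lt _ hp).le (coeffs_le_one n N _)).trans_eq (mul_one p)

theorem row_eq (β n s p : ℕ) (E : List ℕ) (N : ℕ) :
    row (β ^ (n + 1)) s p E (geom β n β) N = pack β (rowDigits n s p E N) := by
  unfold rowDigits
  rw [pack_prod β (fun a : Fin s => 2 ^ (lin E N / 1000 ^ (a : ℕ) % 1000) % p), row, blocks_eq,
    lin_eq (length_geom β n β), pack_succ]
  refine congrArg₂ Nat.mul ?_ rfl
  rw [Nat.succ_eq_one_add, coeffs, Fin.cons_zero, Fin.tail_cons, pack, Finset.mul_sum]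
  refine congrArg (1 + ·) (Finset.sum_congr rfl fun j _ => ?_)
  rw [getD_geom β j.2]
  ring

/-- The rows at `N, N + K, …`. -/
def rowsFrom (K B s p : ℕ) (E U : List ℕ) (f : ℕ) : ℕ → List ℕ :=
  Nat.rec (fun _ => []) (fun _ ih N => row B s p E U N :: ih (Nat.add N K)) f

theorem exists_of_mem_rowsFrom {K B s p : ℕ} {E U : List ℕ} {f N R : ℕ}
    (h : R ∈ rowsFrom K B s p E U f N) : ∃ t < f, R = row B s p E U (N + K * t) := by
  induction f generalizing N with
  | zero => exact absurd h List.not_mem_nil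
  | succ f ih =>
    rcases List.mem_cons.1 (show R ∈ row B s p E U N :: rowsFrom K B s p E U f (N + K) from h)
      with rfl | h
    · exact ⟨0, by omega, rfl⟩
    · obtain ⟨t, ht, rfl⟩ := ih h
      exact ⟨t + 1, by omega, by rw [mul_add, mul_one, add_comm (K * t), add_assoc]⟩

/-- The rows at all vertices congruent to `r` modulo `K` have full rank modulo `p`. -/
def classHasFullRank (β K n s p : ℕ) (E : List ℕ) (r : ℕ) : Bool :=
  hasFullRank β p (s * (n + 1))
    (rowsFrom K (β ^ (n + 1)) s p E (geom β n β) ((2 ^ n - 1 - r) / K + 1) r)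

/-- The combination of the values of `g` at `N, N + K, …` with coefficients `c`. -/
def comb (K : ℕ) (g : ℕ → ℕ) (c : List ℕ) : ℕ → ℕ :=
  List.rec (fun _ => 0) (fun x _ ih N => Nat.add (Nat.mul x (g N)) (ih (Nat.add N K))) c

theorem comb_eq (K : ℕ) (g : ℕ → ℕ) (c : List ℕ) (N : ℕ) :
    comb K g c N = ∑ t : Fin c.length, c.get t * g (N + K * t) := by
  induction c generalizing N with
  | nil => rfl
  | cons x c ih =>
    have : comb K g (x :: c) N = x * g N + comb K g c (N + K) := rfl
    rw [this, ih]
    simp only [List.length_cons, Fin.sum_univ_succ, List.get_cons_zero, Fin.val_zero, mul_zero,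
      add_zero, Fin.val_succ, mul_add, mul_one]
    refine congrArg (_ + ·) (Finset.sum_congr rfl fun t _ => ?_)
    rw [add_assoc, add_comm K, List.get_cons_succ']

/-- The first `m` digits of `R` in base `β` are divisible by `p`. -/
def digitsDvd (β p : ℕ) : ℕ → ℕ → Bool
  | 0, _ => true
  | m + 1, R => Nat.beq (R % β % p) 0 && digitsDvd β p m (R / β)

theorem dvd_of_digitsDvd {β p m : ℕ} {d : Fin m → ℕ} (hd : ∀ k, d k < β)
    (h : digitsDvd β p m (pack β d) = true) (k : Fin m) : p ∣ d k := by
  induction m with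
  | zero => exact k.elim0
  | succ m ih =>
    rw [digitsDvd, Bool.and_eq_true, pack_mod (hd 0), pack_div (hd 0)] at h
    exact Fin.cases (Nat.dvd_of_mod_eq_zero (Nat.eq_of_beq_eq_true h.1))
      (ih (fun k => hd k.succ) h.2) k

/-- The packed row `j` of the Hessian of the form with coefficients `c` at the multiples of `K`. -/
def hessRow (β n K : ℕ) (c : List ℕ) (j : ℕ) : ℕ :=
  comb K (fun N => Nat.mul (bit N j) (lin ((geom β n 1).set j 0) N)) c 0

theorem hessRow_eq (β n K : ℕ) (c : List ℕ) (j : Fin n) :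
    hessRow β n K c j = pack β fun l : Fin n => ∑ t : Fin c.length,
      c.get t * (if j = l then 0 else bit (K * t) j * bit (K * t) l) := by
  rw [pack_sum, hessRow, comb_eq]
  refine Finset.sum_congr rfl fun t _ => congrArg (_ * ·) ?_
  rw [zero_add, lin_eq ((List.length_set).trans (length_geom β n 1))]
  refine (Finset.mul_sum _ _ _).trans (Finset.sum_congr rfl fun l _ => ?_)
  beta_reduce
  by_cases h : j = l
  · subst h
    rw [if_pos rfl, List.getD_eq_getElem?_getD,
      List.getElem?_set_self (by rw [length_geom]; exact j.2)]
    simp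
  · rw [if_neg h, List.getD_eq_getElem?_getD, List.getElem?_set_ne (fun h' => h (Fin.ext h')),
      ← List.getD_eq_getElem?_getD, getD_geom 1 l.2]
    ring

end Rows

section Certificate

variable {F : Type*} [Field F] {n : ℕ}

theorem one_pow_eq (y : F) (c : Fin 2) : (![1, y] : Fin 2 → F) c = y ^ (c : ℕ) := by
  fin_cases c <;> simp

theorem zero_pow_eq (y : F) (c : Fin 2) :
    (![0, y] : Fin 2 → F) c = (c : ℕ) * y ^ (c : ℕ) := by
  fin_cases c <;> simp

theorem tan_affine (y : Fin n → F) (o : Option (Fin n)) (b : Cube n) :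
    tan (fun l => ![1, y l]) (fun l => ![0, y l]) o b =
      o.elim 1 (fun j => ((b j : ℕ) : F)) * ∏ l, y l ^ (b l : ℕ) := by
  cases o with
  | none => simp only [tan, seg, one_pow_eq, Option.elim_none, one_mul]
  | some j =>
    have h : ∀ l, Function.update (fun l => (![1, y l] : Fin 2 → F)) j ![0, y j] l (b l) =
        (if l = j then ((b l : ℕ) : F) else 1) * y l ^ (b l : ℕ) := by
      intro l
      by_cases hl : l = j
      · subst hl
        rw [Function.update_self, if_pos rfl, zero_pow_eq]
      · rw [Function.update_of_ne hl, if_neg hl, one_pow_eq, one_mul]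
    simp only [tan, seg, h, Finset.prod_mul_distrib, Finset.prod_ite_eq', Finset.mem_univ, if_true,
      Option.elim_some]

theorem tan₂_affine (y : Fin n → F) {j l : Fin n} (hjl : j ≠ l) (b : Cube n) :
    tan₂ (fun l => ![1, y l]) (fun l => ![0, y l]) j l b =
      ((b j : ℕ) : F) * ((b l : ℕ) : F) * ∏ l, y l ^ (b l : ℕ) := by
  have h : ∀ m, Function.update (Function.update (fun l => (![1, y l] : Fin 2 → F)) j ![0, y j]) l
      ![0, y l] m (b m) = (if m = j then ((b m : ℕ) : F) else 1) *
        (if m = l then ((b m : ℕ) : F) else 1) * y m ^ (b m : ℕ) := by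
    intro m
    by_cases hm : m = l
    · subst hm
      rw [Function.update_self, if_pos rfl, if_neg (Ne.symm hjl), zero_pow_eq, one_mul]
    · rw [Function.update_of_ne hm, if_neg hm, mul_one]
      by_cases hm' : m = j
      · subst hm'
        rw [Function.update_self, if_pos rfl, zero_pow_eq]
      · rw [Function.update_of_ne hm', if_neg hm', one_pow_eq, one_mul]
  simp only [tan₂, seg, h, Finset.prod_mul_distrib, Finset.prod_ite_eq', Finset.mem_univ, if_true]

/-- The number with binary digits `b`. -/
def num (b : Cube n) : ℕ := finFunctionFinEquiv b

theorem num_eq (b : Cube n) : num b = ∑ l, (b l : ℕ) * 2 ^ (l : ℕ) :=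
  finFunctionFinEquiv_apply b

theorem bit_num (b : Cube n) (l : Fin n) : bit (num b) l = b l := by
  rw [bit, num, ← finFunctionFinEquiv_symm_apply_val, Equiv.symm_apply_apply]

theorem num_injective : Function.Injective (num (n := n)) := fun _ _ h =>
  finFunctionFinEquiv.injective (Fin.ext h)

theorem exists_num_eq {N : ℕ} (h : N < 2 ^ n) : ∃ b : Cube n, num b = N :=
  ⟨finFunctionFinEquiv.symm ⟨N, h⟩, by rw [num, Equiv.apply_symm_apply]⟩

/-- Exponents are bounded so that sums of `n` of them are single digits in base `1000`, and
all the exponents of the first point vanish. -/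
def ExponentsOk (n s : ℕ) (E : List ℕ) : Prop :=
  E.length = n ∧ ∀ x ∈ E, x < 1000 ^ s ∧ x % 1000 = 0 ∧ ∀ a < s, x / 1000 ^ a % 1000 ≤ 999 / n

/-- The exponent of `2` in the `l`-th coordinate of the `a`-th point. -/
def expo (E : List ℕ) (a l : ℕ) : ℕ := E.getD l 0 / 1000 ^ a % 1000

theorem lin_digit {s : ℕ} {E : List ℕ} (hE : ExponentsOk n s E) (N : ℕ) (a : Fin s) :
    lin E N / 1000 ^ (a : ℕ) % 1000 = ∑ l : Fin n, bit N l * expo E a l := by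
  obtain ⟨hl, hE⟩ := hE
  have hmem : ∀ l : Fin n, E.getD l 0 ∈ E := fun l => by
    rw [List.getD_eq_getElem _ _ (by rw [hl]; exact l.2)]
    exact List.getElem_mem _
  have hlin : lin E N = pack 1000 fun a : Fin s => ∑ l : Fin n, bit N l * expo E a l := by
    rw [lin_eq hl]
    refine Eq.trans ?_ (pack_sum Finset.univ (fun l : Fin n => bit N l)
      fun l (a : Fin s) => expo E a l).symm
    exact Finset.sum_congr rfl fun l _ => congrArg (_ * ·) (pack_digits (hE _ (hmem l)).1).symm
  rw [hlin, pack_digit (fun a => ?_) a]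
  calc ∑ l : Fin n, bit N l * expo E a l ≤ ∑ _l : Fin n, 999 / n :=
        Finset.sum_le_sum fun l _ => (Nat.mul_le_mul (bit_le_one N l)
          ((hE _ (hmem l)).2.2 a a.2)).trans_eq (one_mul _)
    _ ≤ 999 := by
        rw [Finset.sum_const, Finset.card_univ, Fintype.card_fin, smul_eq_mul]
        exact Nat.mul_div_le _ _
    _ < 1000 := by norm_num

/-- The points with coordinates `ζ ^ (i * 2 ^ l) * 2 ^ e` for the exponents `e` given by `E`. -/
def points (ζ : F) (K s : ℕ) (E : List ℕ) : PIdx (Fin K × Fin s) n → F := fun g =>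
  ![if g.2.1 then 0 else 1, ζ ^ ((g.1.1 : ℕ) * 2 ^ (g.2.2.1 : ℕ)) * 2 ^ expo E g.1.2 g.2.2.1]
    g.2.2.2

theorem pt_points (ζ : F) (K s : ℕ) (E : List ℕ) (g : Fin K × Fin s) :
    pt (points (n := n) ζ K s E) g =
      fun l : Fin n => ![1, ζ ^ ((g.1 : ℕ) * 2 ^ (l : ℕ)) * 2 ^ expo E g.2 l] := rfl

theorem dir_points (ζ : F) (K s : ℕ) (E : List ℕ) (g : Fin K × Fin s) :
    dir (points (n := n) ζ K s E) g =
      fun l : Fin n => ![0, ζ ^ ((g.1 : ℕ) * 2 ^ (l : ℕ)) * 2 ^ expo E g.2 l] := rfl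

theorem prod_points (ζ : F) {s : ℕ} {E : List ℕ} (hE : ExponentsOk n s E) (i : ℕ) (a : Fin s)
    (b : Cube n) : ∏ l : Fin n, (ζ ^ (i * 2 ^ (l : ℕ)) * 2 ^ expo E a l) ^ (b l : ℕ) =
      ζ ^ (i * num b) * 2 ^ (lin E (num b) / 1000 ^ (a : ℕ) % 1000) := by
  rw [lin_digit hE, num_eq, Finset.mul_sum, ← Finset.prod_pow_eq_pow_sum,
    ← Finset.prod_pow_eq_pow_sum, ← Finset.prod_mul_distrib, ← num_eq]
  refine Finset.prod_congr rfl fun l _ => ?_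
  rw [bit_num, mul_pow, ← pow_mul, ← pow_mul]
  ring_nf

theorem elim_eq_coeffs (b : Cube n) (o : Option (Fin n)) :
    o.elim 1 (fun j => ((b j : ℕ) : F)) = (coeffs n (num b) ((finSuccEquiv n).symm o) : ℕ) := by
  cases o with
  | none => rw [finSuccEquiv_symm_none, coeffs, Fin.cons_zero, Nat.cast_one, Option.elim_none]
  | some j => rw [finSuccEquiv_symm_some, coeffs, Fin.cons_succ, bit_num, Option.elim_some]

/-- The position in a packed row of the tangent vector `o` at the `a`-th point. -/
def slot (n s : ℕ) : Fin s × Option (Fin n) ≃ Fin (s * (n + 1)) :=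
  ((Equiv.refl _).prodCongr (finSuccEquiv n).symm).trans finProdFinEquiv

theorem rowDigits_slot {s : ℕ} (p : ℕ) [CharP F p] (E : List ℕ) (b : Cube n) (a : Fin s)
    (o : Option (Fin n)) : (rowDigits n s p E (num b) (slot n s (a, o)) : F) =
      o.elim 1 (fun j => ((b j : ℕ) : F)) * 2 ^ (lin E (num b) / 1000 ^ (a : ℕ) % 1000) := by
  have h : finProdFinEquiv.symm (slot n s (a, o)) = (a, (finSuccEquiv n).symm o) :=
    Equiv.symm_apply_apply finProdFinEquiv _
  rw [finProdFinEquiv_symm_apply, Prod.mk.injEq] at h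
  rw [rowDigits, h.1, h.2, elim_eq_coeffs, Nat.cast_mul, ← CharP.cast_eq_mod, mul_comm,
    Nat.cast_pow, Nat.cast_ofNat]

theorem gens_points (ζ : F) (p : ℕ) [CharP F p] {K s : ℕ} {E : List ℕ} (hE : ExponentsOk n s E)
    (i : Fin K) (a : Fin s) (o : Option (Fin n)) (b : Cube n) :
    gens (points ζ K s E) ((i, a), o) b =
      ζ ^ ((i : ℕ) * num b) * rowDigits n s p E (num b) (slot n s (a, o)) := by
  rw [gens, pt_points, dir_points, tan_affine, prod_points ζ hE, rowDigits_slot]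
  ring

theorem linearIndependent_points {ζ : F} {K : ℕ} (hζ : IsPrimitiveRoot ζ K) (p : ℕ)
    [Fact p.Prime] [CharP F p] {β s : ℕ} {E : List ℕ} (hE : ExponentsOk n s E)
    (hβ : p ^ (s * (n + 1)) * p < β) (hn : K ≤ 2 ^ n)
    (h : ∀ r < K, classHasFullRank β K n s p E r = true) :
    LinearIndependent F (gens (points (n := n) ζ K s E)) := by
  have hp : p.Prime := Fact.out
  rw [Fintype.linearIndependent_iff]
  rintro c hc ⟨⟨i₀, a₀⟩, o₀⟩
  have hc' : ∀ b : Cube n, ∑ i : Fin K, ∑ k, c ((i, ((slot n s).symm k).1), ((slot n s).symm k).2) *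
      (ζ ^ ((i : ℕ) * num b) * rowDigits n s p E (num b) k) = 0 := by
    intro b
    have := congrFun hc b
    rw [Finset.sum_apply, Fintype.sum_prod_type, Fintype.sum_prod_type] at this
    rw [← Pi.zero_apply (M := fun _ => F) b, ← this]
    refine Finset.sum_congr rfl fun i _ => ?_
    rw [← (slot n s).sum_comp, Fintype.sum_prod_type]
    refine Finset.sum_congr rfl fun a _ => Finset.sum_congr rfl fun o _ => ?_
    rw [Equiv.symm_apply_apply, Pi.smul_apply, smul_eq_mul, gens_points ζ p hE]
  have hK : 0 < K := i₀.pos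
  have hr : ∀ r : Fin K, ∑ i : Fin K, c ((i, a₀), o₀) * (ζ ^ (i : ℕ)) ^ (r : ℕ) = 0 := by
    intro r
    have hzero : (fun k => ∑ i : Fin K, c ((i, ((slot n s).symm k).1), ((slot n s).symm k).2) *
        (ζ ^ (i : ℕ)) ^ (r : ℕ)) = 0 := by
      refine eq_zero_of_hasFullRank p _ hβ (fun R hR => ?_) (h r r.2)
      obtain ⟨t, ht, rfl⟩ := exists_of_mem_rowsFrom hR
      rw [row_eq]
      refine ⟨_, rowDigits_le hp.pos E _, rfl, ?_⟩
      have hlt : (r : ℕ) + K * t < 2 ^ n := by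
        have h1 : K * t ≤ 2 ^ n - 1 - r :=
          (Nat.mul_le_mul_left K (Nat.le_of_lt_succ ht)).trans (Nat.mul_div_le _ _)
        have := r.2
        omega
      obtain ⟨b, hb⟩ := exists_num_eq hlt
      rw [← hc' b, hb, Finset.sum_comm]
      refine Finset.sum_congr rfl fun k _ => ?_
      rw [Finset.mul_sum]
      refine Finset.sum_congr rfl fun i _ => ?_
      have : ζ ^ ((i : ℕ) * (r + K * t)) = (ζ ^ (i : ℕ)) ^ (r : ℕ) := by
        rw [mul_add, pow_add, pow_mul, mul_left_comm, pow_mul ζ K, hζ.pow_eq_one, one_pow, mul_one]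
      rw [this]
      ring
    have := congrFun hzero (slot n s (a₀, o₀))
    simpa only [Equiv.symm_apply_apply, Pi.zero_apply] using this
  have hinj : Function.Injective fun i : Fin K => ζ ^ (i : ℕ) := fun i j hij =>
    Fin.ext (hζ.pow_inj i.2 j.2 hij)
  exact congrFun (Matrix.eq_zero_of_forall_pow_sum_mul_pow_eq_zero
    (v := fun i => c ((i, a₀), o₀)) hinj fun r => hr r) i₀

/-- The form with coefficients `c` at the multiples of `K`. -/
def form (F : Type*) [Field F] (n K : ℕ) (c : List ℕ) : Cube n → F := fun b =>
  ∑ t : Fin c.length, if num b = K * t then (c.get t : F) else 0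

theorem form_dotProduct {K : ℕ} {c : List ℕ} (hc : ∀ t : Fin c.length, K * t < 2 ^ n)
    (g : Cube n → F) (G : ℕ → F) (hG : ∀ b, g b = G (num b)) :
    form F n K c ⬝ᵥ g = ∑ t : Fin c.length, (c.get t : F) * G (K * t) := by
  simp only [dotProduct, form, Finset.sum_mul, hG]
  rw [Finset.sum_comm]
  refine Finset.sum_congr rfl fun t _ => ?_
  obtain ⟨b, hb⟩ := exists_num_eq (hc t)
  rw [Finset.sum_eq_single b]
  · rw [if_pos hb, hb]
  · intro b' _ hb'
    rw [if_neg (fun h => hb' (num_injective (h.trans hb.symm))), zero_mul]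
  · simp

theorem form_dotProduct_gens {ζ : F} {K : ℕ} (hζ : IsPrimitiveRoot ζ K) (p : ℕ)
    [Fact p.Prime] [CharP F p] {β s : ℕ} {E c : List ℕ} (hE : ExponentsOk n s E)
    (hc : ∀ t : Fin c.length, K * t < 2 ^ n) (hβ : c.sum * p < β)
    (h : digitsDvd β p (s * (n + 1))
      (comb K (row (β ^ (n + 1)) s p E (geom β n β)) c 0) = true)
    (g : (Fin K × Fin s) × Option (Fin n)) :
    form F n K c ⬝ᵥ gens (points ζ K s E) g = 0 := by
  have hp : p.Prime := Fact.out
  obtain ⟨⟨i, a⟩, o⟩ := g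
  rw [form_dotProduct hc _ (fun N => ζ ^ ((i : ℕ) * N) * rowDigits n s p E N (slot n s (a, o)))
    (gens_points ζ p hE i a o)]
  have hpow : ∀ t : ℕ, ζ ^ ((i : ℕ) * (K * t)) = 1 := fun t => by
    rw [mul_left_comm, pow_mul, hζ.pow_eq_one, one_pow]
  simp only [hpow, one_mul, ← Nat.cast_mul, ← Nat.cast_sum]
  rw [CharP.cast_eq_zero_iff F p]
  have hcomb : comb K (row (β ^ (n + 1)) s p E (geom β n β)) c 0 = pack β fun k =>
      ∑ t : Fin c.length, c.get t * rowDigits n s p E (K * t) k := by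
    rw [pack_sum, comb_eq]
    simp only [row_eq, zero_add]
  rw [hcomb] at h
  refine dvd_of_digitsDvd (fun k => lt_of_le_of_lt ?_ hβ) h _
  rw [← Fin.sum_univ_getElem c, Finset.sum_mul]
  exact Finset.sum_le_sum fun t _ => Nat.mul_le_mul_left _ (rowDigits_le hp.pos E _ k)

theorem det_hess_form_ne_zero (ζ : F) {K : ℕ} [NeZero K] (p : ℕ) [Fact p.Prime] [CharP F p]
    {β s : ℕ} [NeZero s] {E c : List ℕ} (hE : ExponentsOk n s E)
    (hc : ∀ t : Fin c.length, K * t < 2 ^ n) (hβ : p ^ n * c.sum < β)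
    (h : hasFullRank β p n ((List.range n).map (hessRow β n K c)) = true) :
    (hess (form F n K c) (pt (points ζ K s E) (0, 0)) (dir (points ζ K s E) (0, 0))).det ≠ 0 := by
  have hexp : ∀ l : Fin n, expo E 0 l = 0 := fun l => by
    have hl : (l : ℕ) < E.length := by rw [hE.1]; exact l.2
    rw [expo, pow_zero, Nat.div_one, List.getD_eq_getElem _ _ hl]
    exact (hE.2 _ (List.getElem_mem hl)).2.1
  have hentry : ∀ j l, hess (form F n K c) (pt (points ζ K s E) (0, 0))
      (dir (points ζ K s E) (0, 0)) j l = ((∑ t : Fin c.length, c.get t *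
        (if j = l then 0 else bit (K * t) j * bit (K * t) l) : ℕ) : F) := by
    intro j l
    rw [hess, of_apply]
    by_cases hjl : j = l
    · simp [hjl]
    · rw [if_neg hjl, form_dotProduct hc _ (fun N => (bit N j : F) * bit N l)]
      · simp [hjl]
      · intro b
        rw [pt_points, dir_points, tan₂_affine _ hjl, bit_num, bit_num]
        simp [hexp]
  rw [det_ne_zero_iff]
  intro v hv
  refine eq_zero_of_hasFullRank p v hβ (fun R hR => ?_) h
  obtain ⟨j, hj, rfl⟩ := List.mem_map.1 hR
  have hjn : j < n := List.mem_range.1 hj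
  refine ⟨_, fun l => ?_, hessRow_eq β n K c ⟨j, hjn⟩, ?_⟩
  · rw [← Fin.sum_univ_getElem c]
    refine Finset.sum_le_sum fun t _ => (Nat.mul_le_mul_left _ ?_).trans_eq (mul_one _)
    split_ifs
    · exact zero_le_one
    · exact Nat.mul_le_mul (bit_le_one _ _) (bit_le_one _ _)
  · have := congrFun hv ⟨j, hjn⟩
    simpa only [mulVec, dotProduct, hentry, Pi.zero_apply] using this

/-- A configuration from a verified certificate. -/
theorem Config.of_certificate {K s p β : ℕ} [NeZero K] [NeZero s] [Fact p.Prime] {E c : List ℕ}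
    (hKp : ¬ p ∣ K) (hE : ExponentsOk n s E) (hβ : p ^ (s * (n + 1)) * p < β) (hK : K ≤ 2 ^ n)
    (hclass : ∀ r < K, classHasFullRank β K n s p E r = true)
    (hc : K * (c.length - 1) < 2 ^ n) (hcβ : c.sum * p < β)
    (hdvd : digitsDvd β p (s * (n + 1))
      (comb K (row (β ^ (n + 1)) s p E (geom β n β)) c 0) = true)
    (hnβ : p ^ n * c.sum < β)
    (hhess : hasFullRank β p n ((List.range n).map (hessRow β n K c)) = true) :
    Config ℂ n (Fin K × Fin s) (0, 0) := by
  have : NeZero (K : AlgebraicClosure (ZMod p)) :=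
    ⟨fun h => hKp ((CharP.cast_eq_zero_iff _ p K).1 h)⟩
  have := IsSepClosed.hasEnoughRootsOfUnity (AlgebraicClosure (ZMod p)) K
  obtain ⟨ζ, hζ⟩ := HasEnoughRootsOfUnity.exists_primitiveRoot (AlgebraicClosure (ZMod p)) K
  have hc' : ∀ t : Fin c.length, K * t < 2 ^ n := fun t =>
    (Nat.mul_le_mul_left K (by omega)).trans_lt hc
  exact Config.complex ⟨points ζ K s E, form _ n K c,
    linearIndependent_points hζ p hE hβ hK hclass,
    form_dotProduct_gens hζ p hE hc' hcβ hdvd,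
    det_hess_form_ne_zero ζ p hE hc' hnβ hhess⟩

end Certificate

section BaseCases

/-- Exponents of seven points for twelve factors, as digits in base `1000`. -/
def exponents₁₂ : List ℕ :=
  [8000008002009000000, 6002004003004001000, 7007001000006003000, 2000002001005008000,
    3004007000009002000, 9008008009000004000, 6003005003009002000, 5004003006006004000,
    9001003001004007000, 4001001009009000000, 1001008007009000, 8002004002001005000]

/-- Coefficients of a form singular at the points given by `exponents₁₂`. -/
def coefficients₁₂ : List ℕ :=
  [2, 4, 7, 4, 1, 9, 8, 4, 9, 6, 8, 10, 7, 5, 9, 10, 10, 4, 1, 1, 4, 5, 0, 4, 4, 6, 9, 7, 6, 8, 8,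
    0, 6, 3, 1, 9, 3, 6, 3, 1, 1, 1, 1, 7, 3, 6, 3, 10, 5, 6, 1, 0, 1, 5, 5, 10, 10, 4, 6, 0, 8, 8,
    5, 3, 5, 8, 6, 6, 10, 10, 10, 5, 2, 10, 10, 8, 6, 9, 2, 2, 10, 6, 8, 3, 1, 2, 5, 8, 10, 9, 2, 1]

/-- Exponents of five points for thirteen factors, as digits in base `1000`. -/
def exponents₁₃ : List ℕ :=
  [5005005000000, 15016003015000, 10005004005000, 16011008009000, 10001007009000, 10011011016000,
    11016015001000, 13016004001000, 10014015007000, 17011010000, 7004011001000, 15005006009000,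
    14006003010000]

/-- Coefficients of a form singular at the points given by `exponents₁₃`. -/
def coefficients₁₃ : List ℕ :=
  [0, 16, 11, 8, 8, 1, 13, 6, 3, 3, 4, 8, 5, 17, 0, 14, 15, 10, 6, 16, 3, 18, 1, 9, 6, 2, 16, 3, 7,
    6, 6, 18, 17, 5, 13, 10, 12, 1, 11, 11, 14, 1, 8, 7, 17, 14, 18, 12, 4, 4, 16, 10, 2, 11, 8, 7,
    18, 9, 14, 4, 18, 7, 12, 7, 3, 12, 16, 18, 16, 18, 1]

instance (n s : ℕ) (E : List ℕ) : Decidable (ExponentsOk n s E) := by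
  unfold ExponentsOk
  infer_instance

theorem classHasFullRank₁₂ :
    ∀ r < 45, classHasFullRank (2 ^ 320) 45 12 7 11 exponents₁₂ r = true := by
  decide +kernel

theorem classHasFullRank₁₃ :
    ∀ r < 117, classHasFullRank (2 ^ 320) 117 13 5 19 exponents₁₃ r = true := by
  decide +kernel

theorem config₁₂ : Config ℂ 12 (Fin 315) 0 := by
  have : Fact (Nat.Prime 11) := ⟨by norm_num⟩
  refine Config.of_card_le (Config.of_certificate (K := 45) (s := 7) (p := 11) (β := 2 ^ 320)
    (E := exponents₁₂) (c := coefficients₁₂) (by norm_num) (by decide +kernel) (by decide +kernel)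
    (by norm_num) classHasFullRank₁₂ (by decide +kernel) (by decide +kernel) (by decide +kernel)
    (by decide +kernel) (by decide +kernel)) ?_ 0
  simp

theorem config₁₃ : Config ℂ 13 (Fin 585) 0 := by
  have : Fact (Nat.Prime 19) := ⟨by norm_num⟩
  refine Config.of_card_le (Config.of_certificate (K := 117) (s := 5) (p := 19) (β := 2 ^ 320)
    (E := exponents₁₃) (c := coefficients₁₃) (by norm_num) (by decide +kernel) (by decide +kernel)
    (by norm_num) classHasFullRank₁₃ (by decide +kernel) (by decide +kernel) (by decide +kernel)
    (by decide +kernel) (by decide +kernel)) ?_ 0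
  simp

end BaseCases

end SegreTangent

/-- `n ≥ 12` copies of `ℙ¹`, tangential generality. -/
theorem stmt_4 (n : ℕ) (hn : 12 ≤ n) (r k : ℕ) (hr : 0 < r) (hk : 0 < k)
    (h1 : r + 1 ≤ 2 ^ n - 2 ^ (n - 12))
    (h2 : (k : ℚ) ≤ ((r : ℚ) + 1) / (n + 1)) :
    TangentGeneral n (fun _ => 1) k (r + 1) := by
  have hpow : 2 ^ n = 4096 * 2 ^ (n - 12) := by
    rw [show (4096 : ℕ) = 2 ^ 12 by norm_num, ← pow_add, Nat.add_sub_cancel' hn]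
  have hpos : 0 < 2 ^ (n - 12) := by positivity
  have hkd : k * (n + 1) ≤ r + 1 := by
    rw [le_div_iff₀ (by positivity)] at h2
    exact_mod_cast h2
  exact SegreTangent.tangentGeneral_of_config (by omega) hk
    (fun i => SegreTangent.config_of_base SegreTangent.config₁₂ SegreTangent.config₁₃ n hn k i
      (by omega)) hkd (by omega)
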